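/- Any solution X of dX_u = (2β_u X_u + δ_u) du + σ(X_u) dW_u with X_0 = x ≥ 0, where β, δ ∈ D and σ satisfies the Hölder condition and σ(0)=0, remains nonnegative almost surely: P[X_u ≥ 0] = 1 for all u ≥ 0. -/

import Mathlib

open MeasureTheory ProbabilityTheory Filter

noncomputable section

/-- The path space `C(ℝ⁺, ℝ)` modelled as functions `ℝ → ℝ`. -/
abbrev RPath : Type := ℝ → ℝ

/-- The class `D` of nonnegative, measurable, locally bounded, piecewise
continuous functions. -/
def MemD (f : ℝ → ℝ) : Prop :=
  Measurable f ∧ (∀ t, 0 ≤ f t) ∧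
    (∀ T : ℝ, ∃ C : ℝ, ∀ t ∈ Set.Icc (0 : ℝ) T, f t ≤ C) ∧
    ∃ S : Set ℝ, S.Countable ∧ ∀ t ∉ S, ContinuousAt f t

/-- `W` is a standard Brownian motion with respect to the filtration `ℱ`:
it starts at `0`, has continuous paths, is adapted, has Gaussian increments
`W t - W s ∼ N(0, t - s)` that are independent of `ℱ s`. -/
structure IsBrownianMotion {Ω : Type*} [m : MeasurableSpace Ω] (P : Measure Ω)
    (ℱ : Filtration ℝ m) (W : ℝ → Ω → ℝ) : Prop where
  start : ∀ ω, W 0 ω = 0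
  cont : ∀ ω, Continuous fun t => W t ω
  adapted : Adapted ℱ W
  gaussian_increments : ∀ s t : ℝ, 0 ≤ s → s ≤ t →
    P.map (fun ω => W t ω - W s ω) = gaussianReal 0 (Real.toNNReal (t - s))
  indep_increments : ∀ s t : ℝ, 0 ≤ s → s ≤ t →
    Indep (MeasurableSpace.comap (fun ω => W t ω - W s ω) (borel ℝ)) (ℱ s) P

/-- `X` is a (strong) solution of the SDE `dX_t = b(t, X_t) dt + σ(X_t) dW_t`,
`X_0 = x`, formulated through the martingale problem relative to `W`:
`M_t := X_t - x - ∫_0^t b(s, X_s) ds` is a martingale, its quadratic variation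
is `∫_0^t σ(X_s)² ds`, and its covariation with `W` is `∫_0^t σ(X_s) ds`
(the latter characterizes `M_t = ∫_0^t σ(X_s) dW_s`). -/
structure IsSDESolution {Ω : Type*} [m : MeasurableSpace Ω] (P : Measure Ω)
    (ℱ : Filtration ℝ m) (W : ℝ → Ω → ℝ)
    (b : ℝ → ℝ → ℝ) (σ : ℝ → ℝ) (x : ℝ) (X : ℝ → Ω → ℝ) : Prop where
  init : ∀ ω, X 0 ω = x
  cont : ∀ ω, Continuous fun t => X t ω
  adapted : Adapted ℱ X
  drift_mart : Martingale
    (fun t ω => X t ω - x - ∫ s in Set.Ioc (0 : ℝ) t, b s (X s ω)) ℱ P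
  quad_var : Martingale
    (fun t ω => (X t ω - x - ∫ s in Set.Ioc (0 : ℝ) t, b s (X s ω)) ^ 2
      - ∫ s in Set.Ioc (0 : ℝ) t, (σ (X s ω)) ^ 2) ℱ P
  driven_by : Martingale
    (fun t ω => (X t ω - x - ∫ s in Set.Ioc (0 : ℝ) t, b s (X s ω)) * W t ω
      - ∫ s in Set.Ioc (0 : ℝ) t, σ (X s ω)) ℱ P

/-- The drift `(t, y) ↦ 2 β_t y + δ_t` of the generalized squared Bessel process. -/
def gbesqDrift (β δ : ℝ → ℝ) : ℝ → ℝ → ℝ := fun t y => 2 * β t * y + δ t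

/-- The diffusion coefficient `y ↦ 2 √y` of the squared Bessel process. -/
def besqSigma : ℝ → ℝ := fun y => 2 * Real.sqrt y

/-- `X` is a generalized squared Bessel process `GBESQ^{β,δ}_x` driven by `W`. -/
def IsGBESQ {Ω : Type*} [m : MeasurableSpace Ω] (P : Measure Ω)
    (ℱ : Filtration ℝ m) (W : ℝ → Ω → ℝ) (β δ : ℝ → ℝ) (x : ℝ)
    (X : ℝ → Ω → ℝ) : Prop :=
  IsSDESolution P ℱ W (gbesqDrift β δ) besqSigma x X

/-- The law on path space of a process `X`. -/
def pathLaw {Ω : Type*} [m : MeasurableSpace Ω] (P : Measure Ω)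
    (X : ℝ → Ω → ℝ) : Measure RPath :=
  P.map fun ω t => X t ω

/-- A realization of the generalized squared Bessel process `GBESQ^{β,δ}_x`
whose law on path space is `μ`. -/
structure GBESQRealization (β δ : ℝ → ℝ) (x : ℝ) (μ : Measure RPath) where
  (Ω : Type)
  [m : MeasurableSpace Ω]
  (P : Measure Ω)
  (ℱ : Filtration ℝ m)
  (W : ℝ → Ω → ℝ)
  (X : ℝ → Ω → ℝ)
  (prob : IsProbabilityMeasure P)
  (bm : IsBrownianMotion P ℱ W)
  (sol : IsGBESQ P ℱ W β δ x X)
  (law : μ = pathLaw P X)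

/-- `μ` is the law `{}^β Q^δ_x` of the generalized squared Bessel process with
drift function `β`, dimension function `δ` and initial value `x`. -/
def IsGBESQLaw (β δ : ℝ → ℝ) (x : ℝ) (μ : Measure RPath) : Prop :=
  Nonempty (GBESQRealization β δ x μ)

/-- Convolution of two laws on path space: the law of the pathwise sum of
independent copies. -/
def mconv (μ ν : Measure RPath) : Measure RPath :=
  (μ.prod ν).map fun p => p.1 + p.2


def qPhi (b y : ℝ) : ℝ := max (-y) b * Real.log (max (-y) b / b) - max (-y) b + b
def qL (b y : ℝ) : ℝ := Real.log (max (-y) b / b)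
def qG (b y : ℝ) : ℝ := if y < 0 then (max (-y) b)⁻¹ else 0

lemma log_ge_aux {z : ℝ} (hz : 0 < z) : 1 - 1 / z ≤ Real.log z := by
  have := Real.one_sub_inv_le_log_of_pos hz
  simpa using this

lemma qL_nonneg {b : ℝ} (hb : 0 < b) (y : ℝ) : 0 ≤ qL b y := by
  apply Real.log_nonneg
  rw [le_div_iff₀ hb]; simp

lemma qPhi_nonneg {b : ℝ} (hb : 0 < b) (y : ℝ) : 0 ≤ qPhi b y := by
  unfold qPhi
  set p := max (-y) b
  have hp : b ≤ p := le_max_right _ _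
  have h := log_ge_aux (z := p / b) (by positivity)
  have hp0 : 0 < p := by linarith
  have : p * (1 - 1 / (p / b)) ≤ p * Real.log (p/b) := by gcongr
  have e : p * (1 - 1 / (p / b)) = p - b := by field_simp
  linarith

lemma qG_nonneg {b : ℝ} (hb : 0 < b) (y : ℝ) : 0 ≤ qG b y := by
  unfold qG; split_ifs
  · have : b ≤ max (-y) b := le_max_right _ _
    positivity
  · exact le_rfl

lemma qG_le {b : ℝ} (hb : 0 < b) (y : ℝ) : qG b y ≤ b⁻¹ := by
  unfold qG; split_ifs
  · have : b ≤ max (-y) b := le_max_right _ _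
    gcongr
  · positivity

lemma qG_mul_abs_le {b : ℝ} (hb : 0 < b) (y : ℝ) : qG b y * |y| ≤ 1 := by
  unfold qG; split_ifs with h
  · have h1 : b ≤ max (-y) b := le_max_right _ _
    have h2 : -y ≤ max (-y) b := le_max_left _ _
    rw [abs_of_neg h, inv_mul_le_iff₀ (by linarith)]; linarith
  · simp

lemma qL_le {b R : ℝ} (hb : 0 < b) (hR : b ≤ R) {y : ℝ} (hy : |y| ≤ R) :
    qL b y ≤ Real.log (R / b) := by
  have h1 : b ≤ max (-y) b := le_max_right _ _
  apply Real.log_le_log (by positivity)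
  gcongr
  exact max_le ((neg_le_abs y).trans hy) hR

/-- `-L(y) * y ≤ Φ(y) + R`. -/
lemma qL_mul_le {b R : ℝ} (hb : 0 < b) (hR : b ≤ R) {y : ℝ} (hy : |y| ≤ R) :
    qL b y * (-y) ≤ qPhi b y + R := by
  have h0 := qL_nonneg hb y
  have h1 : b ≤ max (-y) b := le_max_right _ _
  have h2 : -y ≤ max (-y) b := le_max_left _ _
  have h3 : max (-y) b ≤ R := max_le ((neg_le_abs y).trans hy) hR
  have : qL b y * (-y) ≤ qL b y * max (-y) b := by gcongr
  unfold qPhi; unfold qL at *; nlinarith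

lemma qPhi_le {b R : ℝ} (hb : 0 < b) (hR : b ≤ R) {y : ℝ} (hy : |y| ≤ R) :
    qPhi b y ≤ R * Real.log (R / b) := by
  have h0 := qL_nonneg hb y
  have h1 : b ≤ max (-y) b := le_max_right _ _
  have h3 : max (-y) b ≤ R := max_le ((neg_le_abs y).trans hy) hR
  have h4 := qL_le hb hR hy
  have hR0 : 0 ≤ R := by linarith
  have : max (-y) b * qL b y ≤ R * Real.log (R/b) := by gcongr
  unfold qPhi; unfold qL at *; linarith

lemma bregman {p q : ℝ} (hp : 0 < p) (hq : 0 < q) :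
    p * Real.log (p / q) - p + q ≤ q⁻¹ * (p - q)^2 := by
  have := Real.log_le_sub_one_of_pos (show 0 < p / q by positivity)
  have h : p * Real.log (p / q) ≤ p * (p / q - 1) := by gcongr
  have e : q⁻¹ * (p - q)^2 = p * (p / q - 1) - p + q := by field_simp; ring
  linarith

lemma bregman2 {b p q : ℝ} (hb : 0 < b) (hq : b ≤ q) (hp : 0 ≤ p) (hpb : p ≤ b) :
    0 ≤ q * Real.log (q / b) - q + b - Real.log (q / b) * (q - p) + q⁻¹ * (p - q)^2 := by
  have hq0 : 0 < q := by linarith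
  have hl := log_ge_aux (z := q / b) (by positivity)
  have h3 : p * (1 - 1 / (q/b)) ≤ p * Real.log (q/b) := mul_le_mul_of_nonneg_left hl hp
  have e : p * (1 - 1 / (q/b)) - q + b + q⁻¹ * (p - q)^2 = q⁻¹ * ((b - p) * (q - p)) := by
    field_simp; ring
  have : 0 ≤ q⁻¹ * ((b - p) * (q - p)) := by
    apply mul_nonneg (by positivity); apply mul_nonneg <;> linarith
  nlinarith

lemma qPhi_step {b : ℝ} (hb : 0 < b) {y z : ℝ} (h : |z - y| ≤ b) :
    qPhi b z ≤ qPhi b y - qL b y * (z - y) + qG b y * (z - y)^2 := by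
  obtain ⟨h1, h2⟩ := abs_le.1 h
  rcases le_or_gt 0 y with hy | hy
  · have e1 : max (-z) b = b := max_eq_right (by linarith)
    have e2 : max (-y) b = b := max_eq_right (by linarith)
    simp [qPhi, qL, qG, e1, e2, hb.ne', not_lt.2 hy]
  · simp only [qG, hy, if_true]
    rcases le_or_gt (-y) b with hyb | hyb
    · have e2 : max (-y) b = b := max_eq_right hyb
      simp only [qPhi, qL, e2, div_self hb.ne', Real.log_one]
      rcases le_or_gt (-z) b with hzb | hzb
      · simp only [max_eq_right hzb, div_self hb.ne', Real.log_one]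
        have : 0 ≤ b⁻¹ * (z - y)^2 := by positivity
        linarith
      · simp only [max_eq_left hzb.le]
        have := bregman (p := -z) (q := b) (by linarith) hb
        have h3 : b⁻¹ * (-z - b)^2 ≤ b⁻¹ * (z - y)^2 := by
          gcongr ?_ * ?_
          nlinarith
        linarith
    · simp only [qPhi, qL, max_eq_left hyb.le]
      have hq : 0 < -y := by linarith
      rcases le_or_gt (-z) b with hzb | hzb
      · simp only [max_eq_right hzb, div_self hb.ne', Real.log_one]
        have := bregman2 (p := -z) (q := -y) hb hyb.le (by linarith) hzb
        have e : (-z - -y)^2 = (z-y)^2 := by ring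
        rw [e] at this
        linarith
      · simp only [max_eq_left hzb.le]
        have hz : 0 < -z := by linarith
        have := bregman hz hq
        rw [Real.log_div hz.ne' hq.ne'] at this
        rw [Real.log_div hz.ne' hb.ne', Real.log_div hq.ne' hb.ne']
        have e : (-z - -y)^2 = (z-y)^2 := by ring
        rw [e] at this
        linarith

lemma mart_orth {Ω : Type} [m : MeasurableSpace Ω]
    {P : Measure Ω} [IsProbabilityMeasure P] {ℱ : Filtration ℝ m} {Q : ℝ → Ω → ℝ}
    (hQ : Martingale Q ℱ P) {s t : ℝ} (hst : s ≤ t) {f : Ω → ℝ}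
    (hf : StronglyMeasurable[ℱ s] f) (hi : Integrable (fun ω => f ω * (Q t ω - Q s ω)) P) :
    ∫ ω, f ω * (Q t ω - Q s ω) ∂P = 0 := by
  have hd : Integrable (Q t - Q s) P := (hQ.integrable t).sub (hQ.integrable s)
  have h1 : P[f * (Q t - Q s) | ℱ s] =ᵐ[P] f * P[Q t - Q s | ℱ s] :=
    condExp_mul_of_stronglyMeasurable_left hf hi hd
  have h2 : P[Q t - Q s | ℱ s] =ᵐ[P] 0 := by
    have h3 := condExp_sub (hQ.integrable t) (hQ.integrable s) (ℱ s)
    have h4 := hQ.2 s t hst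
    have h5 := hQ.2 s s le_rfl
    filter_upwards [h3, h4, h5] with ω a b c
    rw [a]; simp [b, c]
  have h6 : ∫ ω, P[f * (Q t - Q s) | ℱ s] ω ∂P = ∫ ω, (f * (Q t - Q s)) ω ∂P :=
    integral_condExp (ℱ.le s)
  have h7 : ∫ ω, P[f * (Q t - Q s) | ℱ s] ω ∂P = 0 := by
    rw [integral_congr_ae (g := fun _ => (0:ℝ))]
    · simp
    · filter_upwards [h1, h2] with ω a b
      rw [a]; simp [b]
  rw [h7] at h6
  exact h6.symm

lemma avg_lemma {Ω : Type} [m : MeasurableSpace Ω]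
    {P : Measure Ω} [IsProbabilityMeasure P] {Y : ℝ → Ω → ℝ}
    (hY : Measurable (Function.uncurry Y)) {s t K : ℝ} (hst : s ≤ t)
    (hi : ∀ r ∈ Set.Ioc s t, Integrable (Y r) P)
    (hK : ∀ r ∈ Set.Ioc s t, ∫ ω, |Y r ω| ∂P ≤ K) :
    Integrable (fun ω => ∫ r in Set.Ioc s t, Y r ω) P ∧
    ∫ ω, (∫ r in Set.Ioc s t, Y r ω) ∂P ≤ K * (t - s) := by
  have hprod : Integrable (Function.uncurry Y) ((volume.restrict (Set.Ioc s t)).prod P) := by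
    rw [integrable_prod_iff hY.aestronglyMeasurable]
    constructor
    · exact (ae_restrict_iff' measurableSet_Ioc).2 (Eventually.of_forall fun r hr => hi r hr)
    · refine Measure.integrableOn_of_bounded (M := K) (by simp) ?_ ?_
      · exact (hY.stronglyMeasurable.norm.integral_prod_right').aestronglyMeasurable
      · refine (ae_restrict_iff' measurableSet_Ioc).2 (Eventually.of_forall fun r hr => ?_)
        rw [Real.norm_of_nonneg (integral_nonneg fun _ => norm_nonneg _)]
        exact hK r hr
  refine ⟨hprod.integral_prod_right, ?_⟩
  rw [← integral_integral_swap hprod]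
  calc ∫ r in Set.Ioc s t, ∫ ω, Y r ω ∂P ≤ ∫ r in Set.Ioc s t, K := by
        refine setIntegral_mono_on hprod.integral_prod_left (by simp) measurableSet_Ioc ?_
        intro r hr
        refine le_trans ?_ (hK r hr)
        exact integral_mono (hi r hr) (hi r hr).abs (fun ω => le_abs_self _)
    _ = K * (t - s) := by
        simp [Real.volume_real_Ioc_of_le hst, mul_comm]

lemma cs_lemma {f : ℝ → ℝ} {s t : ℝ} (hst : s < t) (hf : IntegrableOn f (Set.Ioc s t))
    (hf2 : IntegrableOn (fun r => f r ^ 2) (Set.Ioc s t)) :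
    (∫ r in Set.Ioc s t, f r)^2 ≤ (t - s) * ∫ r in Set.Ioc s t, f r ^ 2 := by
  set a := (∫ r in Set.Ioc s t, f r) / (t - s) with ha
  have hd : 0 < t - s := by linarith
  have h0 : 0 ≤ ∫ r in Set.Ioc s t, (f r - a)^2 := integral_nonneg fun _ => sq_nonneg _
  have e : ∫ r in Set.Ioc s t, (f r - a)^2
      = (∫ r in Set.Ioc s t, f r ^ 2) - 2 * a * (∫ r in Set.Ioc s t, f r) + a^2 * (t - s) := by
    have : ∀ r, (f r - a)^2 = f r ^ 2 - 2 * a * f r + a^2 := fun r => by ring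
    simp_rw [this]
    rw [integral_add, integral_sub hf2 (hf.const_mul _), integral_const_mul]
    · simp [Real.volume_real_Ioc_of_le hst.le, mul_comm]
    · exact hf2.sub (hf.const_mul _)
    · simp
  have e2 : ∫ r in Set.Ioc s t, f r = a * (t - s) := by rw [ha]; field_simp
  rw [e, e2] at h0
  rw [e2]
  nlinarith

lemma gron_lemma {f A : ℝ → ℝ} {C T : ℝ} (hC : 0 ≤ C) (hf : Continuous f)
    (hA : ContinuousOn A (Set.Icc 0 T)) (hA0 : ∀ t ∈ Set.Icc 0 T, 0 ≤ A t)
    (h : ∀ t ∈ Set.Icc 0 T, f t ≤ A t + C * ∫ r in Set.Ioc 0 t, f r) :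
    ∀ t ∈ Set.Icc 0 T, f t ≤ A t + C * (Real.exp (C * T) * ∫ r in Set.Ioc 0 T, A r) := by
  intro t ht
  have hIA : IntegrableOn A (Set.Icc 0 T) := hA.integrableOn_Icc
  have hIA' : IntegrableOn A (Set.Ioc 0 T) := hIA.mono_set Set.Ioc_subset_Icc_self
  let u : ℝ → ℝ := fun t => ∫ r in (0:ℝ)..t, f r
  have hu : ∀ t, HasDerivAt u (f t) t := fun t => by
    exact intervalIntegral.integral_hasDerivAt_right (hf.intervalIntegrable _ _)
      (hf.stronglyMeasurableAtFilter _ _) hf.continuousAt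
  have huc : Continuous u := continuous_iff_continuousAt.2 fun t => (hu t).continuousAt
  let w : ℝ → ℝ := fun t => Real.exp (-(C * t)) * u t
  have hw : ∀ t, HasDerivAt w (Real.exp (-(C * t)) * (f t - C * u t)) t := fun t => by
    have h1 : HasDerivAt (fun t => Real.exp (-(C * t))) (Real.exp (-(C*t)) * (-(C * 1))) t :=
      (((hasDerivAt_id t).const_mul C).neg).exp
    convert! h1.mul (hu t) using 1
    ring
  have hwi : w t - w 0 = ∫ r in (0:ℝ)..t, Real.exp (-(C * r)) * (f r - C * u r) := by
    rw [intervalIntegral.integral_eq_sub_of_hasDerivAt (fun r _ => hw r)]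
    apply Continuous.intervalIntegrable
    fun_prop
  have hw0 : w 0 = 0 := by simp [w, u]
  have hle : w t ≤ ∫ r in Set.Ioc 0 T, A r := by
    rw [hw0, sub_zero] at hwi
    rw [hwi, intervalIntegral.integral_of_le ht.1]
    calc _ ≤ ∫ r in Set.Ioc 0 t, A r := by
          refine setIntegral_mono_on ?_ (hIA'.mono_set (Set.Ioc_subset_Ioc_right ht.2))
            measurableSet_Ioc ?_
          · apply (Continuous.integrableOn_Icc _).mono_set Set.Ioc_subset_Icc_self
            fun_prop
          · intro r hr
            have hr' : r ∈ Set.Icc 0 T := ⟨hr.1.le, hr.2.trans ht.2⟩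
            have h1 := h r hr'
            rw [← intervalIntegral.integral_of_le hr.1.le] at h1
            have h2 : f r - C * u r ≤ A r := by simp only [u]; linarith
            have h3 : Real.exp (-(C * r)) ≤ 1 := by
              rw [Real.exp_le_one_iff]; have := mul_nonneg hC hr.1.le; linarith
            have h4 := hA0 r hr'
            have h5 := Real.exp_pos (-(C * r))
            nlinarith
      _ ≤ _ := by
          refine setIntegral_mono_set hIA' ?_ (Set.Ioc_subset_Ioc_right ht.2).eventuallyLE
          exact (ae_restrict_iff' measurableSet_Ioc).2
            (Eventually.of_forall fun r hr => hA0 r ⟨hr.1.le, hr.2⟩)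
  have hu' : u t = Real.exp (C * t) * w t := by
    simp only [w]; rw [← mul_assoc, ← Real.exp_add]; simp
  have hAi : 0 ≤ ∫ r in Set.Ioc 0 T, A r :=
    setIntegral_nonneg measurableSet_Ioc fun r hr => hA0 r ⟨hr.1.le, hr.2⟩
  have h1 := h t ht
  rw [← intervalIntegral.integral_of_le ht.1] at h1
  have h2 : u t ≤ Real.exp (C * T) * ∫ r in Set.Ioc 0 T, A r := by
    rw [hu']
    calc _ ≤ Real.exp (C * t) * ∫ r in Set.Ioc 0 T, A r := by gcongr
      _ ≤ _ := by gcongr; exact ht.2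
  have h3 : C * u t ≤ C * (Real.exp (C * T) * ∫ r in Set.Ioc 0 T, A r) := by gcongr
  simp only [u] at h3
  linarith

def gM {Ω : Type} (β δ : ℝ → ℝ) (x : ℝ) (X : ℝ → Ω → ℝ) (t : ℝ) (ω : Ω) : ℝ :=
  X t ω - x - ∫ s in Set.Ioc (0 : ℝ) t, gbesqDrift β δ s (X s ω)

def gQ {Ω : Type} (σ : ℝ → ℝ) (X : ℝ → Ω → ℝ) (s t : ℝ) (ω : Ω) : ℝ :=
  ∫ r in Set.Ioc s t, (σ (X r ω))^2

def gI {Ω : Type} (β δ : ℝ → ℝ) (X : ℝ → Ω → ℝ) (s t : ℝ) (ω : Ω) : ℝ :=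
  ∫ r in Set.Ioc s t, gbesqDrift β δ r (X r ω)

structure Ctx {Ω : Type} [m : MeasurableSpace Ω] (P : Measure Ω) (ℱ : Filtration ℝ m)
    (β δ σ : ℝ → ℝ) (c x : ℝ) (X : ℝ → Ω → ℝ) (T B D : ℝ) : Prop where
  prob : IsProbabilityMeasure P
  hT : 0 < T
  hB : 0 ≤ B
  hD : 0 ≤ D
  hx : 0 ≤ x
  mβ : Measurable β
  mδ : Measurable δ
  β0 : ∀ t, 0 ≤ β t
  δ0 : ∀ t, 0 ≤ δ t
  βB : ∀ t ∈ Set.Icc (0:ℝ) T, β t ≤ B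
  δD : ∀ t ∈ Set.Icc (0:ℝ) T, δ t ≤ D
  σ0 : σ 0 = 0
  hol : ∀ x y : ℝ, |σ x - σ y| ≤ c * Real.sqrt |x - y|
  init : ∀ ω, X 0 ω = x
  cont : ∀ ω, Continuous fun t => X t ω
  adapted : Adapted ℱ X
  mM : Martingale (gM β δ x X) ℱ P
  mQ : Martingale (fun t ω => gM β δ x X t ω ^ 2 - gQ σ X 0 t ω) ℱ P

section ctx
variable {Ω : Type} [m : MeasurableSpace Ω] {P : Measure Ω} {ℱ : Filtration ℝ m}
    {β δ σ : ℝ → ℝ} {c x : ℝ} {X : ℝ → Ω → ℝ} {T B D : ℝ}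

lemma Ctx.measX (h : Ctx P ℱ β δ σ c x X T B D) : Measurable (Function.uncurry X) :=
  measurable_uncurry_of_continuous_of_measurable h.cont
    fun i => (h.adapted i).mono (ℱ.le i) le_rfl

lemma Ctx.measXt (h : Ctx P ℱ β δ σ c x X T B D) (t : ℝ) : Measurable (X t) :=
  (h.adapted t).mono (ℱ.le t) le_rfl

lemma Ctx.measDrift (h : Ctx P ℱ β δ σ c x X T B D) :
    Measurable (Function.uncurry fun r ω => gbesqDrift β δ r (X r ω)) := by
  have h1 := h.measX
  have h2 : Measurable fun p : ℝ × Ω => β p.1 := h.mβ.comp measurable_fst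
  have h3 : Measurable fun p : ℝ × Ω => δ p.1 := h.mδ.comp measurable_fst
  exact ((measurable_const.mul h2).mul h1).add h3

lemma Ctx.contσ (h : Ctx P ℱ β δ σ c x X T B D) : Continuous σ := by
  rw [continuous_iff_continuousAt]
  intro a
  rw [ContinuousAt, tendsto_iff_dist_tendsto_zero]
  have : Tendsto (fun y => c * Real.sqrt |y - a|) (nhds a) (nhds 0) := by
    have : Continuous fun y => c * Real.sqrt |y - a| := by fun_prop
    simpa using this.tendsto a
  exact squeeze_zero (fun _ => dist_nonneg) (fun y => h.hol y a) this

lemma Ctx.c0 (h : Ctx P ℱ β δ σ c x X T B D) : 0 ≤ c := by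
  have := (abs_nonneg _).trans (h.hol 1 0)
  simpa using this

lemma Ctx.sq_le (h : Ctx P ℱ β δ σ c x X T B D) (y : ℝ) : σ y ^ 2 ≤ c^2 * |y| := by
  have h1 := h.hol y 0
  rw [h.σ0, sub_zero, sub_zero] at h1
  calc σ y ^ 2 = |σ y|^2 := (sq_abs _).symm
    _ ≤ (c * Real.sqrt |y|)^2 := by gcongr
    _ = _ := by rw [mul_pow, Real.sq_sqrt (abs_nonneg _)]

lemma Ctx.drift_abs (h : Ctx P ℱ β δ σ c x X T B D) {r : ℝ} (hr : r ∈ Set.Icc 0 T) (y : ℝ) :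
    |gbesqDrift β δ r y| ≤ 2 * B * |y| + D := by
  unfold gbesqDrift
  have h1 := h.βB r hr
  have h2 := h.δD r hr
  have h3 := h.β0 r
  have h4 := h.δ0 r
  calc _ ≤ |2 * β r * y| + |δ r| := abs_add_le _ _
    _ = 2 * β r * |y| + δ r := by rw [abs_mul, abs_of_nonneg h4, abs_of_nonneg (by positivity)]
    _ ≤ _ := by gcongr

lemma Ctx.contAbs (h : Ctx P ℱ β δ σ c x X T B D) (ω : Ω) :
    Continuous fun r => 2 * B * |X r ω| + D := by
  have := h.cont ω
  fun_prop

lemma cont_intOn {f : ℝ → ℝ} (hf : Continuous f) (s t : ℝ) : IntegrableOn f (Set.Ioc s t) :=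
  hf.integrableOn_Icc.mono_set Set.Ioc_subset_Icc_self

lemma Ctx.driftMeasR (h : Ctx P ℱ β δ σ c x X T B D) (ω : Ω) :
    Measurable fun r => gbesqDrift β δ r (X r ω) :=
  h.measDrift.comp (measurable_id.prodMk measurable_const)

lemma Ctx.drift_int (h : Ctx P ℱ β δ σ c x X T B D) (ω : Ω) :
    IntegrableOn (fun r => gbesqDrift β δ r (X r ω)) (Set.Icc 0 T) := by
  refine Integrable.mono' (h.contAbs ω).integrableOn_Icc
    (h.driftMeasR ω).aestronglyMeasurable ?_
  exact (ae_restrict_iff' measurableSet_Icc).2 (Eventually.of_forall fun r hr => h.drift_abs hr _)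

lemma sub_Icc {s t T : ℝ} (hs : 0 ≤ s) (ht : t ≤ T) : Set.Ioc s t ⊆ Set.Icc 0 T :=
  fun _ hr => ⟨hs.trans hr.1.le, hr.2.trans ht⟩

lemma Ctx.incr (h : Ctx P ℱ β δ σ c x X T B D) {s t : ℝ} (hs : 0 ≤ s) (hst : s ≤ t) (ht : t ≤ T)
    (ω : Ω) : X t ω - X s ω = (gM β δ x X t ω - gM β δ x X s ω) + gI β δ X s t ω := by
  have e : Set.Ioc 0 t = Set.Ioc 0 s ∪ Set.Ioc s t := (Set.Ioc_union_Ioc_eq_Ioc hs hst).symm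
  have := setIntegral_union (μ := volume) (f := fun r => gbesqDrift β δ r (X r ω))
    (s := Set.Ioc 0 s) (t := Set.Ioc s t) (Set.Ioc_disjoint_Ioc_of_le le_rfl) measurableSet_Ioc
    ((h.drift_int ω).mono_set (sub_Icc le_rfl (hst.trans ht)))
    ((h.drift_int ω).mono_set (sub_Icc hs ht))
  rw [← e] at this
  simp only [gM, gI]
  rw [this]; ring

lemma Ctx.gI_abs (h : Ctx P ℱ β δ σ c x X T B D) {s t : ℝ} (hs : 0 ≤ s) (ht : t ≤ T)
    (ω : Ω) : |gI β δ X s t ω| ≤ ∫ r in Set.Ioc s t, (2 * B * |X r ω| + D) := by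
  unfold gI
  refine (abs_integral_le_integral_abs).trans ?_
  refine setIntegral_mono_on ((h.drift_int ω).mono_set (sub_Icc hs ht)).abs
    (cont_intOn (h.contAbs ω) _ _) measurableSet_Ioc ?_
  intro r hr
  exact h.drift_abs (sub_Icc hs ht hr) _

lemma Ctx.measM (h : Ctx P ℱ β δ σ c x X T B D) :
    Measurable (Function.uncurry (gM β δ x X)) := by
  have h1 : Measurable fun q : (ℝ × Ω) × ℝ =>
      (Set.Ioc (0:ℝ) q.1.1).indicator (fun s => gbesqDrift β δ s (X s q.1.2)) q.2 := by
    have : (fun q : (ℝ × Ω) × ℝ =>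
      (Set.Ioc (0:ℝ) q.1.1).indicator (fun s => gbesqDrift β δ s (X s q.1.2)) q.2)
      = Set.indicator {q : (ℝ × Ω) × ℝ | 0 < q.2 ∧ q.2 ≤ q.1.1}
        (fun q => gbesqDrift β δ q.2 (X q.2 q.1.2)) := by
      ext q
      simp only [Set.indicator, Set.mem_Ioc, Set.mem_ofPred_eq]
    rw [this]
    refine Measurable.indicator ?_ ?_
    · exact h.measDrift.comp (measurable_snd.prodMk (measurable_snd.comp measurable_fst))
    · exact (measurableSet_lt measurable_const measurable_snd).inter
        (measurableSet_le measurable_snd (measurable_fst.comp measurable_fst))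
  have h2 := h1.stronglyMeasurable.integral_prod_right' (ν := (volume : Measure ℝ))
  have h3 : (fun p : ℝ × Ω => ∫ s, (Set.Ioc (0:ℝ) p.1).indicator
      (fun s => gbesqDrift β δ s (X s p.2)) s)
      = fun p : ℝ × Ω => ∫ s in Set.Ioc (0:ℝ) p.1, gbesqDrift β δ s (X s p.2) := by
    ext p; rw [integral_indicator measurableSet_Ioc]
  have h4 : Measurable fun p : ℝ × Ω => ∫ s in Set.Ioc (0:ℝ) p.1, gbesqDrift β δ s (X s p.2) := by
    rw [← h3]; exact h2.measurable
  exact (h.measX.sub measurable_const).sub h4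

lemma Ctx.contM (h : Ctx P ℱ β δ σ c x X T B D) (ω : Ω) :
    ContinuousOn (fun t => gM β δ x X t ω) (Set.Icc 0 T) := by
  have := intervalIntegral.continuousOn_primitive (h.drift_int ω)
  exact ((h.cont ω).continuousOn.sub continuousOn_const).sub this

lemma Ctx.path_bound (h : Ctx P ℱ β δ σ c x X T B D) (ω : Ω) {t : ℝ} (ht : t ∈ Set.Icc 0 T) :
    |X t ω| ≤ (x + D * T + |gM β δ x X t ω|) + 2 * B * (Real.exp (2 * B * T) *
      ∫ r in Set.Ioc 0 T, (x + D * T + |gM β δ x X r ω|)) := by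
  have hB := h.hB
  have hD := h.hD
  have hT := h.hT
  have hx := h.hx
  refine gron_lemma (f := fun t => |X t ω|) (A := fun t => x + D * T + |gM β δ x X t ω|)
    (C := 2 * B) (by linarith) (h.cont ω).abs (continuousOn_const.add (h.contM ω).abs)
    (fun t _ => by positivity) ?_ t ht
  intro t ht
  have h1 := h.gI_abs (le_refl 0) ht.2 ω
  have e : X t ω = gM β δ x X t ω + x + gI β δ X 0 t ω := by
    simp only [gM, gI]; ring
  have h2 : |X t ω| ≤ |gM β δ x X t ω| + x + |gI β δ X 0 t ω| := by
    rw [e]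
    calc _ ≤ |gM β δ x X t ω + x| + |gI β δ X 0 t ω| := abs_add_le _ _
      _ ≤ |gM β δ x X t ω| + |x| + |gI β δ X 0 t ω| := by gcongr; exact abs_add_le _ _
      _ = _ := by rw [abs_of_nonneg hx]
  have h3 : ∫ r in Set.Ioc 0 t, (2 * B * |X r ω| + D)
      = 2 * B * (∫ r in Set.Ioc 0 t, |X r ω|) + D * t := by
    rw [integral_add, integral_const_mul]
    · simp [Real.volume_real_Ioc_of_le ht.1, mul_comm]
    · exact (cont_intOn (h.cont ω).abs _ _).const_mul _
    · simp
  have h4 : D * t ≤ D * T := by gcongr; exact ht.2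
  linarith

lemma Ctx.measMt (h : Ctx P ℱ β δ σ c x X T B D) (t : ℝ) : Measurable (gM β δ x X t) :=
  h.measM.comp (measurable_const.prodMk measurable_id)

lemma Ctx.M1 (h : Ctx P ℱ β δ σ c x X T B D) {s t : ℝ} (hst : s ≤ t) :
    ∫ ω, |gM β δ x X s ω| ∂P ≤ ∫ ω, |gM β δ x X t ω| ∂P := by
  have h1 := h.mM.2 s t hst
  have h2 := integral_abs_condExp_le (m := ℱ s) (μ := P) (gM β δ x X t)
  refine le_trans (le_of_eq ?_) h2
  apply integral_congr_ae
  filter_upwards [h1] with ω hω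
  rw [hω]

lemma Ctx.A1 (h : Ctx P ℱ β δ σ c x X T B D) :
    ∃ K, 0 ≤ K ∧ ∀ t ∈ Set.Icc 0 T, Integrable (fun ω => x + D * T + |gM β δ x X t ω|) P ∧
      ∫ ω, |(x + D * T + |gM β δ x X t ω|)| ∂P ≤ K := by
  have := h.prob
  have hB := h.hB
  have hD := h.hD
  have hT := h.hT
  have hx := h.hx
  refine ⟨x + D * T + ∫ ω, |gM β δ x X T ω| ∂P, ?_, fun t ht => ?_⟩
  · have : 0 ≤ ∫ ω, |gM β δ x X T ω| ∂P := integral_nonneg fun _ => abs_nonneg _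
    positivity
  have hi := (h.mM.integrable t).abs
  refine ⟨(integrable_const _).add hi, ?_⟩
  have e : ∀ ω, |(x + D * T + |gM β δ x X t ω|)| = x + D * T + |gM β δ x X t ω| := fun ω =>
    abs_of_nonneg (by positivity)
  simp_rw [e]
  rw [integral_add (integrable_const _) hi]
  have := h.M1 ht.2
  simp
  linarith

lemma Ctx.X1 (h : Ctx P ℱ β δ σ c x X T B D) :
    ∃ K, 0 ≤ K ∧ ∀ t ∈ Set.Icc 0 T, Integrable (X t) P ∧ ∫ ω, |X t ω| ∂P ≤ K := by
  have := h.prob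
  have hB := h.hB
  have hD := h.hD
  have hT := h.hT
  have hx := h.hx
  obtain ⟨K, hK, hA⟩ := h.A1
  have hm : Measurable (Function.uncurry fun r ω => x + D * T + |gM β δ x X r ω|) :=
    measurable_const.add h.measM.abs
  obtain ⟨i1, i2⟩ := avg_lemma hm (K := K) h.hT.le
    (fun r hr => (hA r ⟨hr.1.le, hr.2⟩).1) (fun r hr => (hA r ⟨hr.1.le, hr.2⟩).2)
  refine ⟨K + 2 * B * (Real.exp (2 * B * T) * (K * (T - 0))), ?_, fun t ht => ?_⟩
  · have : 0 ≤ T - 0 := by linarith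
    positivity
  have hb := fun ω => h.path_bound ω ht
  have hI : Integrable (fun ω => (x + D * T + |gM β δ x X t ω|) + 2 * B * (Real.exp (2 * B * T) *
      ∫ r in Set.Ioc 0 T, (x + D * T + |gM β δ x X r ω|))) P :=
    (hA t ht).1.add ((i1.const_mul _).const_mul _)
  have hXi : Integrable (X t) P :=
    hI.mono' (h.measXt t).aestronglyMeasurable (Eventually.of_forall hb)
  refine ⟨hXi, ?_⟩
  refine (integral_mono hXi.abs hI hb).trans ?_
  rw [integral_add (hA t ht).1 ((i1.const_mul _).const_mul _), integral_const_mul,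
    integral_const_mul]
  have h1 := (integral_mono (hA t ht).1 (hA t ht).1.abs (fun ω => le_abs_self _)).trans (hA t ht).2
  gcongr

lemma Ctx.Q1 (h : Ctx P ℱ β δ σ c x X T B D) :
    ∃ K, 0 ≤ K ∧ ∀ s t, 0 ≤ s → s ≤ t → t ≤ T →
      Integrable (gQ σ X s t) P ∧ ∫ ω, gQ σ X s t ω ∂P ≤ K * (t - s) := by
  have := h.prob
  obtain ⟨K, hK, hX⟩ := h.X1
  refine ⟨c^2 * K, by positivity, fun s t hs hst ht => ?_⟩
  have hm : Measurable (Function.uncurry fun r ω => σ (X r ω)^2) :=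
    (h.contσ.measurable.comp h.measX).pow_const 2
  have hi : ∀ r ∈ Set.Ioc s t, Integrable (fun ω => σ (X r ω)^2) P := fun r hr => by
    refine ((hX r (sub_Icc hs ht hr)).1.abs.const_mul (c^2)).mono'
      ((h.contσ.measurable.comp (h.measXt r)).pow_const 2).aestronglyMeasurable ?_
    refine Eventually.of_forall fun ω => ?_
    rw [Real.norm_of_nonneg (sq_nonneg _)]
    exact h.sq_le _
  refine avg_lemma hm hst hi fun r hr => ?_
  have hXr := hX r (sub_Icc hs ht hr)
  calc ∫ ω, |σ (X r ω)^2| ∂P ≤ ∫ ω, c^2 * |X r ω| ∂P := by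
        refine integral_mono (hi r hr).abs (hXr.1.abs.const_mul _) fun ω => ?_
        rw [abs_of_nonneg (sq_nonneg (σ (X r ω)))]
        exact h.sq_le _
    _ ≤ _ := by rw [integral_const_mul]; gcongr; exact hXr.2

lemma Ctx.M2 (h : Ctx P ℱ β δ σ c x X T B D) :
    ∃ K, 0 ≤ K ∧ ∀ t ∈ Set.Icc 0 T,
      Integrable (fun ω => gM β δ x X t ω ^ 2) P ∧ ∫ ω, gM β δ x X t ω ^ 2 ∂P ≤ K := by
  have := h.prob
  have hT := h.hT
  obtain ⟨K, hK, hQ⟩ := h.Q1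
  refine ⟨K * T, by positivity, fun t ht => ?_⟩
  obtain ⟨q1, q2⟩ := hQ 0 t le_rfl ht.1 ht.2
  have hi := (h.mQ.integrable t).add q1
  have e : ((fun ω => gM β δ x X t ω ^ 2 - gQ σ X 0 t ω) + gQ σ X 0 t)
    = fun ω => gM β δ x X t ω ^ 2 := by ext ω; simp
  rw [e] at hi
  refine ⟨hi, ?_⟩
  have h1 := mart_orth h.mQ ht.1 (f := fun _ => 1) stronglyMeasurable_const
    (by simp only [one_mul]; exact ((h.mQ.integrable t).sub (h.mQ.integrable 0)))
  simp only [one_mul] at h1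
  have e0 : ∀ ω, gM β δ x X 0 ω ^ 2 - gQ σ X 0 0 ω = 0 := fun ω => by
    simp [gM, gQ, h.init]
  simp only [e0, sub_zero] at h1
  rw [integral_sub hi q1] at h1
  have : K * (t - 0) ≤ K * T := by gcongr; linarith [ht.2]
  linarith

lemma Ctx.A2 (h : Ctx P ℱ β δ σ c x X T B D) :
    ∃ K, 0 ≤ K ∧ ∀ t ∈ Set.Icc 0 T, Integrable (fun ω => (x + D * T + |gM β δ x X t ω|)^2) P ∧
      ∫ ω, |(x + D * T + |gM β δ x X t ω|)^2| ∂P ≤ K := by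
  have := h.prob
  obtain ⟨K, hK, hM⟩ := h.M2
  refine ⟨2 * (x + D * T)^2 + 2 * K, by positivity, fun t ht => ?_⟩
  obtain ⟨m1, m2⟩ := hM t ht
  have hI : Integrable (fun ω => 2 * (x + D * T)^2 + 2 * gM β δ x X t ω ^ 2) P :=
    (integrable_const _).add (m1.const_mul _)
  have hle : ∀ ω, |(x + D * T + |gM β δ x X t ω|)^2|
      ≤ 2 * (x + D * T)^2 + 2 * gM β δ x X t ω ^ 2 := fun ω => by
    rw [abs_of_nonneg (sq_nonneg _), ← sq_abs (gM β δ x X t ω)]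
    nlinarith [sq_nonneg (x + D * T - |gM β δ x X t ω|)]
  have hi : Integrable (fun ω => (x + D * T + |gM β δ x X t ω|)^2) P :=
    hI.mono' (((h.measMt t).abs.const_add _).pow_const 2).aestronglyMeasurable
      (Eventually.of_forall hle)
  refine ⟨hi, (integral_mono hi.abs hI hle).trans ?_⟩
  rw [integral_add (integrable_const _) (m1.const_mul _), integral_const, integral_const_mul]
  simp only [probReal_univ, one_smul]
  linarith

lemma Ctx.X2 (h : Ctx P ℱ β δ σ c x X T B D) :
    ∃ K, 0 ≤ K ∧ ∀ t ∈ Set.Icc 0 T, Integrable (fun ω => X t ω ^ 2) P ∧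
      ∫ ω, X t ω ^ 2 ∂P ≤ K := by
  have := h.prob
  have hB := h.hB
  have hD := h.hD
  have hT := h.hT
  have hx := h.hx
  obtain ⟨K, hK, hA⟩ := h.A2
  have hm : Measurable (Function.uncurry fun r ω => (x + D * T + |gM β δ x X r ω|)^2) :=
    (measurable_const.add h.measM.abs).pow_const 2
  obtain ⟨i1, i2⟩ := avg_lemma hm (K := K) h.hT.le
    (fun r hr => (hA r ⟨hr.1.le, hr.2⟩).1) (fun r hr => (hA r ⟨hr.1.le, hr.2⟩).2)
  set E := 2 * B * Real.exp (2 * B * T) with hE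
  refine ⟨2 * K + 2 * E^2 * T * (K * (T - 0)), ?_, fun t ht => ?_⟩
  · have : 0 ≤ T - 0 := by linarith
    positivity
  have hb : ∀ ω, X t ω ^ 2 ≤ 2 * (x + D * T + |gM β δ x X t ω|)^2 +
      2 * E^2 * T * ∫ r in Set.Ioc 0 T, (x + D * T + |gM β δ x X r ω|)^2 := fun ω => by
    have h1 := h.path_bound ω ht
    have hc : ContinuousOn (fun r => x + D * T + |gM β δ x X r ω|) (Set.Icc 0 T) :=
      continuousOn_const.add (h.contM ω).abs
    have h2 := cs_lemma h.hT (hc.integrableOn_Icc.mono_set Set.Ioc_subset_Icc_self)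
      ((hc.pow 2).integrableOn_Icc.mono_set Set.Ioc_subset_Icc_self)
    set I1 := ∫ r in Set.Ioc 0 T, (x + D * T + |gM β δ x X r ω|)
    set I2 := ∫ r in Set.Ioc 0 T, (x + D * T + |gM β δ x X r ω|)^2
    set a := x + D * T + |gM β δ x X t ω|
    have h3 : |X t ω| ≤ a + E * I1 := by rw [hE]; linarith
    have h4 : X t ω ^ 2 ≤ (a + E * I1)^2 := by
      rw [← sq_abs (X t ω)]; gcongr
    have h5 : E^2 * I1^2 ≤ E^2 * ((T - 0) * I2) := by gcongr
    nlinarith [sq_nonneg (a - E * I1)]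
  have hI := ((hA t ht).1.const_mul 2).add (i1.const_mul (2 * E^2 * T))
  have hXi : Integrable (fun ω => X t ω ^ 2) P := by
    refine hI.mono' ((h.measXt t).pow_const 2).aestronglyMeasurable
      (Eventually.of_forall fun ω => ?_)
    rw [Real.norm_of_nonneg (sq_nonneg _)]
    exact hb ω
  refine ⟨hXi, (integral_mono hXi hI hb).trans ?_⟩
  simp only [Pi.add_apply]
  rw [integral_add ((hA t ht).1.const_mul 2) (i1.const_mul _), integral_const_mul,
    integral_const_mul]
  have h1 := (integral_mono (hA t ht).1 (hA t ht).1.abs (fun ω => le_abs_self _)).trans (hA t ht).2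
  gcongr

lemma int_bdd_mul {f g : Ω → ℝ} {C : ℝ} (hg : Integrable g P) (hf : Measurable f)
    (hC : ∀ ω, |f ω| ≤ C) : Integrable (fun ω => f ω * g ω) P :=
  hg.bdd_mul (c := C) hf.aestronglyMeasurable (Eventually.of_forall hC)

lemma Ctx.gQ_add (h : Ctx P ℱ β δ σ c x X T B D) {s t : ℝ} (hs : 0 ≤ s) (hst : s ≤ t) (ω : Ω) :
    gQ σ X 0 t ω = gQ σ X 0 s ω + gQ σ X s t ω := by
  have hc : Continuous fun r => σ (X r ω)^2 := (h.contσ.comp (h.cont ω)).pow 2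
  have e : Set.Ioc 0 t = Set.Ioc 0 s ∪ Set.Ioc s t := (Set.Ioc_union_Ioc_eq_Ioc hs hst).symm
  unfold gQ
  rw [e]
  exact setIntegral_union (Set.Ioc_disjoint_Ioc_of_le le_rfl) measurableSet_Ioc
    (cont_intOn hc _ _) (cont_intOn hc _ _)

lemma Ctx.lin (h : Ctx P ℱ β δ σ c x X T B D) {s t : ℝ} (hst : s ≤ t)
    {f : Ω → ℝ} (hf : StronglyMeasurable[ℱ s] f) {C : ℝ} (hC : ∀ ω, |f ω| ≤ C) :
    Integrable (fun ω => f ω * (gM β δ x X t ω - gM β δ x X s ω)) P ∧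
    ∫ ω, f ω * (gM β δ x X t ω - gM β δ x X s ω) ∂P = 0 := by
  have := h.prob
  have hi : Integrable (fun ω => f ω * (gM β δ x X t ω - gM β δ x X s ω)) P :=
    int_bdd_mul ((h.mM.integrable t).sub (h.mM.integrable s)) (hf.measurable.mono (ℱ.le s) le_rfl) hC
  exact ⟨hi, mart_orth h.mM hst hf hi⟩

lemma int_mul_of_sq {f g : Ω → ℝ} (hf : Measurable f) (hg : Measurable g)
    (hf2 : Integrable (fun ω => f ω ^ 2) P) (hg2 : Integrable (fun ω => g ω ^ 2) P) :
    Integrable (fun ω => f ω * g ω) P := by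
  refine (hf2.add hg2).mono' (hf.mul hg).aestronglyMeasurable (Eventually.of_forall fun ω => ?_)
  rw [Real.norm_eq_abs, abs_mul]
  simp only [Pi.add_apply]
  rw [← sq_abs (f ω), ← sq_abs (g ω)]
  nlinarith [sq_nonneg (|f ω| - |g ω|), abs_nonneg (f ω), abs_nonneg (g ω)]

lemma Ctx.quad (h : Ctx P ℱ β δ σ c x X T B D) {s t : ℝ} (hs : 0 ≤ s) (hst : s ≤ t) (ht : t ≤ T)
    {f : Ω → ℝ} (hf : StronglyMeasurable[ℱ s] f) {C : ℝ} (hC : ∀ ω, |f ω| ≤ C) :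
    Integrable (fun ω => f ω * (gM β δ x X t ω - gM β δ x X s ω)^2) P ∧
    Integrable (fun ω => f ω * gQ σ X s t ω) P ∧
    ∫ ω, f ω * (gM β δ x X t ω - gM β δ x X s ω)^2 ∂P = ∫ ω, f ω * gQ σ X s t ω ∂P := by
  have := h.prob
  have hfm : Measurable f := hf.measurable.mono (ℱ.le s) le_rfl
  obtain ⟨K, hK, hM⟩ := h.M2
  obtain ⟨K', hK', hQ⟩ := h.Q1
  have ms := (hM s ⟨hs, hst.trans ht⟩).1
  have mt := (hM t ⟨hs.trans hst, ht⟩).1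
  have mst := int_mul_of_sq (h.measMt s) (h.measMt t) ms mt
  have hq := (hQ s t hs hst ht).1
  have i3 : Integrable (fun ω => f ω * gQ σ X s t ω) P := int_bdd_mul hq hfm hC
  have i1 : Integrable (fun ω => (f ω * gM β δ x X s ω) * (gM β δ x X t ω - gM β δ x X s ω)) P := by
    refine (int_bdd_mul (mst.sub ms) hfm hC).congr (Eventually.of_forall fun ω => ?_)
    simp only [Pi.sub_apply]; ring
  have i2 : Integrable (fun ω => f ω * ((gM β δ x X t ω ^ 2 - gQ σ X 0 t ω)
      - (gM β δ x X s ω ^ 2 - gQ σ X 0 s ω))) P :=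
    int_bdd_mul ((h.mQ.integrable t).sub (h.mQ.integrable s)) hfm hC
  have o1 := mart_orth h.mM hst (hf.mul (h.mM.1 s)) i1
  have o2 := mart_orth h.mQ hst hf i2
  have e : ∀ ω, f ω * (gM β δ x X t ω - gM β δ x X s ω)^2 =
      (f ω * ((gM β δ x X t ω ^ 2 - gQ σ X 0 t ω) - (gM β δ x X s ω ^ 2 - gQ σ X 0 s ω))
      - 2 * ((f ω * gM β δ x X s ω) * (gM β δ x X t ω - gM β δ x X s ω)))
      + f ω * gQ σ X s t ω := fun ω => by
    rw [h.gQ_add hs hst ω]; ring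
  have i4 : Integrable (fun ω => f ω * ((gM β δ x X t ω ^ 2 - gQ σ X 0 t ω)
      - (gM β δ x X s ω ^ 2 - gQ σ X 0 s ω))
      - 2 * ((f ω * gM β δ x X s ω) * (gM β δ x X t ω - gM β δ x X s ω))) P :=
    i2.sub (i1.const_mul 2)
  simp_rw [e]
  refine ⟨i4.add i3, i3, ?_⟩
  rw [integral_add i4 i3]
  have : ∫ ω, (f ω * ((gM β δ x X t ω ^ 2 - gQ σ X 0 t ω) - (gM β δ x X s ω ^ 2 - gQ σ X 0 s ω))
      - 2 * ((f ω * gM β δ x X s ω) * (gM β δ x X t ω - gM β δ x X s ω))) ∂P = 0 := by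
    rw [integral_sub i2 (i1.const_mul 2), integral_const_mul, o2]
    have o1' : ∫ ω, (f ω * gM β δ x X s ω) * (gM β δ x X t ω - gM β δ x X s ω) ∂P = 0 := o1
    rw [o1']; simp
  rw [this, zero_add]

lemma Ctx.meas_gI (h : Ctx P ℱ β δ σ c x X T B D) {s t : ℝ} (hs : 0 ≤ s) (hst : s ≤ t)
    (ht : t ≤ T) : Measurable (gI β δ X s t) := by
  have : gI β δ X s t = fun ω => X t ω - X s ω - (gM β δ x X t ω - gM β δ x X s ω) := by
    ext ω; rw [h.incr hs hst ht ω]; ring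
  rw [this]
  exact ((h.measXt t).sub (h.measXt s)).sub ((h.measMt t).sub (h.measMt s))

lemma Ctx.I2 (h : Ctx P ℱ β δ σ c x X T B D) :
    ∃ K, 0 ≤ K ∧ ∀ s t, 0 ≤ s → s ≤ t → t ≤ T →
      Integrable (fun ω => gI β δ X s t ω ^ 2) P ∧
      ∫ ω, gI β δ X s t ω ^ 2 ∂P ≤ K * (t - s)^2 := by
  have := h.prob
  have hB := h.hB
  have hD := h.hD
  obtain ⟨K, hK, hX⟩ := h.X2
  refine ⟨8 * B^2 * K + 2 * D^2, by positivity, fun s t hs hst ht => ?_⟩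
  rcases hst.eq_or_lt with rfl | hlt
  · simp [gI]
  have hm : Measurable (Function.uncurry fun r ω => (2 * B * |X r ω| + D)^2) :=
    ((measurable_const.mul h.measX.abs).add measurable_const).pow_const 2
  have hle : ∀ r ω, |(2 * B * |X r ω| + D)^2| ≤ 8 * B^2 * X r ω ^ 2 + 2 * D^2 := fun r ω => by
    rw [abs_of_nonneg (sq_nonneg _), ← sq_abs (X r ω)]
    nlinarith [sq_nonneg (2 * B * |X r ω| - D)]
  have hI : ∀ r ∈ Set.Ioc s t, Integrable (fun ω => 8 * B^2 * X r ω ^ 2 + 2 * D^2) P :=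
    fun r hr => ((hX r (sub_Icc hs ht hr)).1.const_mul _).add (integrable_const _)
  have hi : ∀ r ∈ Set.Ioc s t, Integrable (fun ω => (2 * B * |X r ω| + D)^2) P := fun r hr =>
    (hI r hr).mono' (((measurable_const.mul (h.measXt r).abs).add
      measurable_const).pow_const 2).aestronglyMeasurable (Eventually.of_forall (hle r))
  obtain ⟨a1, a2⟩ := avg_lemma (K := 8 * B^2 * K + 2 * D^2) hm hst hi (fun r hr => by
    refine (integral_mono (hi r hr).abs (hI r hr) (hle r)).trans ?_
    rw [integral_add ((hX r (sub_Icc hs ht hr)).1.const_mul _) (integrable_const _),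
      integral_const, integral_const_mul]
    simp only [probReal_univ, one_smul]
    gcongr
    exact (hX r (sub_Icc hs ht hr)).2)
  have hle2 : ∀ ω, gI β δ X s t ω ^ 2
      ≤ (t - s) * ∫ r in Set.Ioc s t, (2 * B * |X r ω| + D)^2 := fun ω => by
    have h1 := h.gI_abs hs ht ω
    refine le_trans ?_ (cs_lemma hlt (cont_intOn (h.contAbs ω) _ _)
      (cont_intOn ((h.contAbs ω).pow 2) _ _))
    rw [← sq_abs (gI β δ X s t ω)]
    gcongr
  have hJ := a1.const_mul (t - s)
  have hG : Integrable (fun ω => gI β δ X s t ω ^ 2) P := by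
    refine hJ.mono' ((h.meas_gI hs hst ht).pow_const 2).aestronglyMeasurable
      (Eventually.of_forall fun ω => ?_)
    rw [Real.norm_of_nonneg (sq_nonneg _)]
    exact hle2 ω
  refine ⟨hG, (integral_mono hG hJ hle2).trans ?_⟩
  rw [integral_const_mul]
  calc _ ≤ (t - s) * ((8 * B^2 * K + 2 * D^2) * (t - s)) := by
        have : 0 ≤ t - s := by linarith
        gcongr
    _ = _ := by ring

lemma Ctx.moments (h : Ctx P ℱ β δ σ c x X T B D) :
    ∃ K, 0 ≤ K ∧ ∀ s t, 0 ≤ s → s ≤ t → t ≤ T →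
      (Integrable (fun ω => gI β δ X s t ω ^ 2) P ∧
        ∫ ω, gI β δ X s t ω ^ 2 ∂P ≤ K * (t - s)^2) ∧
      (Integrable (fun ω => (X t ω - X s ω)^2) P ∧
        ∫ ω, (X t ω - X s ω)^2 ∂P ≤ K * (t - s)) ∧
      ∀ l > 0, Integrable (fun ω => ∫ r in Set.Ioc s t, |X r ω - X s ω|) P ∧
        ∫ ω, (∫ r in Set.Ioc s t, |X r ω - X s ω|) ∂P ≤ (l + K * (t - s) / l) * (t - s) := by
  have := h.prob
  have hT := h.hT
  obtain ⟨K1, hK1, hI⟩ := h.I2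
  obtain ⟨K2, hK2, hQ⟩ := h.Q1
  have key : ∀ s t, 0 ≤ s → s ≤ t → t ≤ T → Integrable (fun ω => (X t ω - X s ω)^2) P ∧
        ∫ ω, (X t ω - X s ω)^2 ∂P ≤ (2 * K2 + 2 * K1 * T) * (t - s) := by
    intro s t hs hst ht
    obtain ⟨q1, q2, q3⟩ := h.quad hs hst ht (f := fun _ => 1) stronglyMeasurable_const (C := 1)
      (by simp)
    simp only [one_mul] at q1 q2 q3
    obtain ⟨i1, i2⟩ := hI s t hs hst ht
    have hle : ∀ ω, (X t ω - X s ω)^2 ≤ 2 * (gM β δ x X t ω - gM β δ x X s ω)^2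
        + 2 * gI β δ X s t ω ^ 2 := fun ω => by
      rw [h.incr hs hst ht ω]
      nlinarith [sq_nonneg ((gM β δ x X t ω - gM β δ x X s ω) - gI β δ X s t ω)]
    have hJ := (q1.const_mul 2).add (i1.const_mul 2)
    have hX : Integrable (fun ω => (X t ω - X s ω)^2) P := by
      refine hJ.mono' (((h.measXt t).sub (h.measXt s)).pow_const 2).aestronglyMeasurable
        (Eventually.of_forall fun ω => ?_)
      rw [Real.norm_of_nonneg (sq_nonneg _)]
      exact hle ω
    refine ⟨hX, (integral_mono hX hJ hle).trans ?_⟩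
    simp only [Pi.add_apply]
    rw [integral_add (q1.const_mul 2) (i1.const_mul 2), integral_const_mul, integral_const_mul, q3]
    have h1 := (hQ s t hs hst ht).2
    have h2 : K1 * (t - s)^2 ≤ K1 * T * (t - s) := by
      have : (t - s) * (t - s) ≤ T * (t - s) := by
        apply mul_le_mul_of_nonneg_right <;> linarith
      nlinarith
    linarith
  refine ⟨K1 + (2 * K2 + 2 * K1 * T), by positivity, fun s t hs hst ht => ⟨⟨?_, ?_⟩, ⟨?_, ?_⟩, ?_⟩⟩
  · exact (hI s t hs hst ht).1
  · refine (hI s t hs hst ht).2.trans ?_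
    gcongr
    have : 0 ≤ 2 * K2 + 2 * K1 * T := by positivity
    linarith
  · exact (key s t hs hst ht).1
  · refine (key s t hs hst ht).2.trans ?_
    have : 0 ≤ t - s := by linarith
    exact mul_le_mul_of_nonneg_right (by linarith) this
  · intro l hl
    have hm : Measurable (Function.uncurry fun r ω => |X r ω - X s ω|) :=
      (h.measX.sub ((h.measXt s).comp measurable_snd)).abs
    have hle : ∀ r ω, |X r ω - X s ω| ≤ l + l⁻¹ * (X r ω - X s ω)^2 := fun r ω => by
      rw [← sq_abs (X r ω - X s ω)]
      set a := |X r ω - X s ω|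
      have e : l + l⁻¹ * a^2 - a = l⁻¹ * ((l - a/2)^2 + 3/4*a^2) := by field_simp; ring
      have : 0 ≤ l⁻¹ * ((l - a/2)^2 + 3/4*a^2) := by positivity
      linarith
    have hJ : ∀ r ∈ Set.Ioc s t, Integrable (fun ω => l + l⁻¹ * (X r ω - X s ω)^2) P :=
      fun r hr => (integrable_const _).add
        ((key s r hs hr.1.le (hr.2.trans ht)).1.const_mul _)
    have hi : ∀ r ∈ Set.Ioc s t, Integrable (fun ω => |X r ω - X s ω|) P := fun r hr =>
      (hJ r hr).mono' ((h.measXt r).sub (h.measXt s)).abs.aestronglyMeasurable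
        (Eventually.of_forall fun ω => by simpa using hle r ω)
    refine avg_lemma hm hst hi fun r hr => ?_
    simp only [abs_abs]
    refine (integral_mono (hi r hr) (hJ r hr) (hle r)).trans ?_
    have hk := key s r hs hr.1.le (hr.2.trans ht)
    rw [integral_add (integrable_const _) (hk.1.const_mul _), integral_const, integral_const_mul]
    simp only [probReal_univ, one_smul]
    have h3 : (2 * K2 + 2 * K1 * T) * (r - s) ≤ (K1 + (2 * K2 + 2 * K1 * T)) * (t - s) := by
      have : 0 ≤ t - s := by linarith
      have : 0 ≤ r - s := by linarith [hr.1]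
      have : 0 ≤ 2 * K2 + 2 * K1 * T := by positivity
      exact mul_le_mul (by linarith) (by linarith [hr.2]) (by assumption) (by linarith)
    rw [div_eq_inv_mul]
    gcongr
    exact hk.2.trans h3

def IntLe (P : Measure Ω) (f : Ω → ℝ) (v : ℝ) : Prop := Integrable f P ∧ ∫ ω, f ω ∂P ≤ v

lemma IntLe.add {f g : Ω → ℝ} {v w : ℝ} (hf : IntLe P f v) (hg : IntLe P g w) :
    IntLe P (fun ω => f ω + g ω) (v + w) :=
  ⟨hf.1.add hg.1, by rw [integral_add hf.1 hg.1]; exact add_le_add hf.2 hg.2⟩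

lemma IntLe.cmul {f : Ω → ℝ} {v a : ℝ} (ha : 0 ≤ a) (hf : IntLe P f v) :
    IntLe P (fun ω => a * f ω) (a * v) :=
  ⟨hf.1.const_mul a, by rw [integral_const_mul]; exact mul_le_mul_of_nonneg_left hf.2 ha⟩

lemma meas_qPhi (b : ℝ) : Measurable (qPhi b) := by unfold qPhi; fun_prop
lemma meas_qL (b : ℝ) : Measurable (qL b) := by unfold qL; fun_prop
lemma meas_qG (b : ℝ) : Measurable (qG b) := by
  unfold qG
  refine Measurable.ite measurableSet_Iio ?_ measurable_const
  fun_prop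

lemma aff_int {g : ℝ → ℝ} (hg : Continuous g) {s t : ℝ} (hst : s ≤ t) (a k : ℝ) :
    ∫ r in Set.Ioc s t, (a + k * g r) = a * (t - s) + k * ∫ r in Set.Ioc s t, g r := by
  have h1 : IntegrableOn (fun _ : ℝ => a) (Set.Ioc s t) := cont_intOn continuous_const _ _
  rw [integral_add h1 ((cont_intOn hg s t).const_mul k), integral_const_mul]
  simp [Real.volume_real_Ioc_of_le hst, mul_comm]

lemma Ctx.gI_low (h : Ctx P ℱ β δ σ c x X T B D) {s t : ℝ} (hs : 0 ≤ s) (hst : s ≤ t) (ht : t ≤ T)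
    {b R : ℝ} (hb : 0 < b) (hR : b ≤ R) {ω : Ω} (hω : |X s ω| ≤ R) :
    -(qL b (X s ω) * gI β δ X s t ω) ≤ 2 * B * (t - s) * (qPhi b (X s ω) + R)
      + 2 * B * Real.log (R / b) * ∫ r in Set.Ioc s t, |X r ω - X s ω| := by
  have hB := h.hB
  have q0 := qL_nonneg hb (X s ω)
  have q1 := qL_le hb hR hω
  have q2 := qL_mul_le hb hR hω
  have q3 := qPhi_nonneg hb (X s ω)
  have hR0 : 0 ≤ R := by linarith
  have hcx := h.cont ω
  have ic : IntegrableOn (fun r => |X r ω - X s ω|) (Set.Ioc s t) :=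
    cont_intOn (by fun_prop) _ _
  have ig := (h.drift_int ω).mono_set (sub_Icc hs ht)
  have e : 2 * B * (t - s) * (qPhi b (X s ω) + R)
      + 2 * B * Real.log (R / b) * ∫ r in Set.Ioc s t, |X r ω - X s ω|
      = ∫ r in Set.Ioc s t, (2 * B * (qPhi b (X s ω) + R)
        + 2 * B * Real.log (R / b) * |X r ω - X s ω|) := by
    rw [aff_int (g := fun r => |X r ω - X s ω|) (by fun_prop) hst]; ring
  rw [e, gI, ← integral_const_mul, ← integral_neg]
  refine setIntegral_mono_on (ig.const_mul _).neg (cont_intOn (by fun_prop) _ _)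
    measurableSet_Ioc fun r hr => ?_
  have h1 := h.βB r (sub_Icc hs ht hr)
  have h3 := h.β0 r
  have h4 := h.δ0 r
  unfold gbesqDrift
  have a1 : -X r ω ≤ -X s ω + |X r ω - X s ω| := by
    have := neg_abs_le (X r ω - X s ω); linarith
  have a2 : qL b (X s ω) * (-X r ω) ≤ (qPhi b (X s ω) + R)
      + Real.log (R / b) * |X r ω - X s ω| := by
    have := mul_le_mul_of_nonneg_left a1 q0
    have := mul_le_mul_of_nonneg_right q1 (abs_nonneg (X r ω - X s ω))
    linarith
  have a3 : 0 ≤ (qPhi b (X s ω) + R) + Real.log (R / b) * |X r ω - X s ω| := by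
    have : 0 ≤ Real.log (R / b) := q0.trans q1
    positivity
  have a4 := mul_le_mul_of_nonneg_left a2 h3
  have a5 := mul_le_mul_of_nonneg_right h1 a3
  have a6 := mul_nonneg q0 h4
  nlinarith

lemma Ctx.gQ_up (h : Ctx P ℱ β δ σ c x X T B D) {s t : ℝ} (hst : s ≤ t)
    {b : ℝ} (hb : 0 < b) (ω : Ω) :
    qG b (X s ω) * gQ σ X s t ω ≤ c^2 * ((t - s) + b⁻¹ * ∫ r in Set.Ioc s t, |X r ω - X s ω|) := by
  have hcx := h.cont ω
  have g0 := qG_nonneg hb (X s ω)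
  have g1 := qG_le hb (X s ω)
  have g2 := qG_mul_abs_le hb (X s ω)
  have ic : IntegrableOn (fun r => |X r ω - X s ω|) (Set.Ioc s t) :=
    cont_intOn (by fun_prop) _ _
  have hc : Continuous fun r => σ (X r ω)^2 := (h.contσ.comp (h.cont ω)).pow 2
  have e : c^2 * ((t - s) + b⁻¹ * ∫ r in Set.Ioc s t, |X r ω - X s ω|)
      = ∫ r in Set.Ioc s t, (c^2 + c^2 * b⁻¹ * |X r ω - X s ω|) := by
    rw [aff_int (g := fun r => |X r ω - X s ω|) (by fun_prop) hst]; ring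
  rw [e, gQ, ← integral_const_mul]
  refine setIntegral_mono_on ((cont_intOn hc _ _).const_mul _)
    (cont_intOn (by fun_prop) _ _)
    measurableSet_Ioc fun r hr => ?_
  have a1 := h.sq_le (X r ω)
  have a2 : |X r ω| ≤ |X s ω| + |X r ω - X s ω| := by
    have := abs_add_le (X s ω) (X r ω - X s ω)
    simpa using this
  have a3 : qG b (X s ω) * |X r ω| ≤ 1 + b⁻¹ * |X r ω - X s ω| := by
    have := mul_le_mul_of_nonneg_left a2 g0
    have := mul_le_mul_of_nonneg_right g1 (abs_nonneg (X r ω - X s ω))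
    linarith
  have a4 := mul_le_mul_of_nonneg_left a1 g0
  have a5 := mul_le_mul_of_nonneg_left a3 (sq_nonneg c)
  linarith

lemma Ctx.step (h : Ctx P ℱ β δ σ c x X T B D) {s t : ℝ} (hs : 0 ≤ s) (hst : s ≤ t) (ht : t ≤ T)
    {b R l K j : ℝ} (hb : 0 < b) (hR : b ≤ R) (hl : 0 < l)
    (hI : IntLe P (fun ω => gI β δ X s t ω ^ 2) (K * (t - s)^2))
    (hH : IntLe P (fun ω => (X t ω - X s ω)^2) (K * (t - s)))
    (hJ : IntLe P (fun ω => ∫ r in Set.Ioc s t, |X r ω - X s ω|) j)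
    {G G' : Set Ω} (hG : MeasurableSet[ℱ s] G) (hGR : ∀ ω ∈ G, |X s ω| ≤ R)
    (hG' : G' ⊆ G) (hGb : ∀ ω ∈ G', |X t ω - X s ω| ≤ b) :
    ∫ ω, G'.indicator (fun ω => qPhi b (X t ω)) ω ∂P ≤
      (1 + 2 * B * (t - s)) * ∫ ω, G.indicator (fun ω => qPhi b (X s ω)) ω ∂P
      + (2 * B * R * (t - s) + 2 * B * Real.log (R / b) * j
        + 2 * (c^2 * ((t - s) + b⁻¹ * j)) + 2 * b⁻¹ * (K * (t - s)^2)
        + Real.log (R / b) * l * (K * (t - s)))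
      + Real.log (R / b) * l⁻¹ * P.real (G ∩ {ω | b < |X t ω - X s ω|}) := by
  have := h.prob
  have hB := h.hB
  have hR0 : 0 ≤ R := by linarith
  have hL : 0 ≤ Real.log (R / b) := Real.log_nonneg (by rw [le_div_iff₀ hb]; linarith)
  have hΔ : 0 ≤ t - s := by linarith
  have hGm : MeasurableSet G := ℱ.le s _ hG
  have hbad : MeasurableSet (G ∩ {ω | b < |X t ω - X s ω|}) :=
    hGm.inter (measurableSet_lt measurable_const ((h.measXt t).sub (h.measXt s)).abs)
  set fP := G.indicator (fun ω => qPhi b (X s ω)) with hfP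
  set fL := G.indicator (fun ω => qL b (X s ω)) with hfL
  set fG := G.indicator (fun ω => qG b (X s ω)) with hfG
  set eb := (G ∩ {ω | b < |X t ω - X s ω|}).indicator (fun _ => (1:ℝ)) with heb
  have mL : StronglyMeasurable[ℱ s] fL :=
    (((meas_qL b).comp (h.adapted s)).indicator hG).stronglyMeasurable
  have mG : StronglyMeasurable[ℱ s] fG :=
    (((meas_qG b).comp (h.adapted s)).indicator hG).stronglyMeasurable
  have bL : ∀ ω, |fL ω| ≤ Real.log (R / b) := fun ω => by
    by_cases hω : ω ∈ G
    · simp only [hfL, Set.indicator_of_mem hω]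
      rw [abs_of_nonneg (qL_nonneg hb _)]
      exact qL_le hb hR (hGR ω hω)
    · simp [hfL, hω, hL]
  have bG : ∀ ω, |fG ω| ≤ b⁻¹ := fun ω => by
    by_cases hω : ω ∈ G
    · simp only [hfG, Set.indicator_of_mem hω]
      rw [abs_of_nonneg (qG_nonneg hb _)]
      exact qG_le hb _
    · simp [hfG, hω, hb.le]
  have iP : Integrable fP P := by
    refine Integrable.of_bound (C := R * Real.log (R / b))
      (((meas_qPhi b).comp (h.measXt s)).indicator hGm).aestronglyMeasurable
      (Eventually.of_forall fun ω => ?_)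
    by_cases hω : ω ∈ G
    · simp only [hfP, Set.indicator_of_mem hω]
      rw [Real.norm_of_nonneg (qPhi_nonneg hb _)]
      exact qPhi_le hb hR (hGR ω hω)
    · simp only [hfP, Set.indicator_of_notMem hω, norm_zero]; positivity
  have l1 := h.lin hst mL bL
  have l2 : IntLe P (fun ω => -(fL ω * (gM β δ x X t ω - gM β δ x X s ω))) 0 :=
    ⟨l1.1.neg, by rw [integral_neg, l1.2, neg_zero]⟩
  obtain ⟨z1, z2, z3⟩ := h.quad hs hst ht mG bG
  have hconst : ∀ a : ℝ, IntLe P (fun _ => a) a := fun a => ⟨integrable_const _, by simp⟩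
  have q1 : IntLe P (fun ω => fG ω * (gM β δ x X t ω - gM β δ x X s ω)^2)
      (c^2 * ((t - s) + b⁻¹ * j)) := by
    have hK := ((hconst (t - s)).add (hJ.cmul (inv_nonneg.2 hb.le))).cmul (sq_nonneg c)
    refine ⟨z1, ?_⟩
    rw [z3]
    refine le_trans (integral_mono z2 hK.1 fun ω => ?_) hK.2
    by_cases hω : ω ∈ G
    · simp only [hfG, Set.indicator_of_mem hω]
      exact h.gQ_up hst hb ω
    · simp only [hfG, Set.indicator_of_notMem hω, zero_mul]
      have : 0 ≤ ∫ r in Set.Ioc s t, |X r ω - X s ω| := integral_nonneg fun _ => abs_nonneg _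
      positivity
  have e1 : IntLe P eb (P.real (G ∩ {ω | b < |X t ω - X s ω|})) :=
    ⟨(integrable_const _).indicator hbad, by
      rw [heb, integral_indicator hbad]; simp⟩
  have p1 : IntLe P fP (∫ ω, fP ω ∂P) := ⟨iP, le_rfl⟩
  have tot := ((((((p1.cmul (a := 1 + 2 * B * (t - s)) (by positivity)).add
    ((hconst (2 * B * R * (t - s))).add
    ((hJ.cmul (a := 2 * B * Real.log (R / b)) (by positivity))))).add l2).add
    (q1.cmul (a := 2) (by norm_num))).add (hI.cmul (a := 2 * b⁻¹) (by positivity))).add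
    (hH.cmul (a := Real.log (R / b) * l) (by positivity))).add
    (e1.cmul (a := Real.log (R / b) * l⁻¹) (by positivity))
  refine (integral_mono_of_nonneg (Eventually.of_forall fun ω => ?_) tot.1
    (Eventually.of_forall fun ω => ?_)).trans (tot.2.trans (le_of_eq (by ring)))
  · exact Set.indicator_nonneg (fun _ _ => qPhi_nonneg hb _) ω
  by_cases hω : ω ∈ G
  swap
  · have hω' : ω ∉ G' := fun hh => hω (hG' hh)
    have : 0 ≤ ∫ r in Set.Ioc s t, |X r ω - X s ω| := integral_nonneg fun _ => abs_nonneg _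
    simp only [hfP, hfL, hfG, heb, Set.indicator_of_notMem hω, Set.indicator_of_notMem hω']
    have : 0 ≤ (G ∩ {ω | b < |X t ω - X s ω|}).indicator (fun _ => (1:ℝ)) ω :=
      Set.indicator_nonneg (fun _ _ => zero_le_one) ω
    simp only [zero_mul, neg_zero, mul_zero, add_zero, zero_add]
    positivity
  have glow := h.gI_low hs hst ht hb hR (hGR ω hω)
  have hinc := h.incr hs hst ht ω
  have g0 := qG_nonneg hb (X s ω)
  have g1 := qG_le hb (X s ω)
  have qb : qG b (X s ω) * (X t ω - X s ω)^2 ≤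
      2 * (qG b (X s ω) * (gM β δ x X t ω - gM β δ x X s ω)^2) + 2 * b⁻¹ * gI β δ X s t ω ^ 2 := by
    rw [hinc]
    have a1 := mul_le_mul_of_nonneg_right g1 (sq_nonneg (gI β δ X s t ω))
    have a2 := mul_nonneg g0 (sq_nonneg ((gM β δ x X t ω - gM β δ x X s ω) - gI β δ X s t ω))
    nlinarith
  have main : G'.indicator (fun ω => qPhi b (X t ω)) ω ≤ qPhi b (X s ω)
      - qL b (X s ω) * (X t ω - X s ω) + qG b (X s ω) * (X t ω - X s ω)^2
      + Real.log (R / b) * l * (X t ω - X s ω)^2 + Real.log (R / b) * l⁻¹ * eb ω := by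
    by_cases hj : |X t ω - X s ω| ≤ b
    · have st := qPhi_step hb hj
      have a1 : G'.indicator (fun ω => qPhi b (X t ω)) ω ≤ qPhi b (X t ω) :=
        Set.indicator_le_self' (fun _ _ => qPhi_nonneg hb _) ω
      have a2 : 0 ≤ eb ω := Set.indicator_nonneg (fun _ _ => zero_le_one) ω
      have a3 : 0 ≤ Real.log (R / b) * l * (X t ω - X s ω)^2 := by positivity
      have a4 : 0 ≤ Real.log (R / b) * l⁻¹ * eb ω := by positivity
      linarith
    · have hω' : ω ∉ G' := fun hh => hj (hGb ω hh)
      have e2 : eb ω = 1 := Set.indicator_of_mem (s := G ∩ {ω | b < |X t ω - X s ω|}) ⟨hω, not_le.1 hj⟩ _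
      rw [Set.indicator_of_notMem hω', e2]
      have q3 := qPhi_nonneg hb (X s ω)
      have q0 := qL_nonneg hb (X s ω)
      have q1 := qL_le hb hR (hGR ω hω)
      have a1 : 0 ≤ qG b (X s ω) * (X t ω - X s ω)^2 := by positivity
      have a2 : qL b (X s ω) * (X t ω - X s ω) ≤ Real.log (R / b) * |X t ω - X s ω| :=
        (mul_le_mul_of_nonneg_left (le_abs_self _) q0).trans
          (mul_le_mul_of_nonneg_right q1 (abs_nonneg _))
      have a3 : |X t ω - X s ω| ≤ l * (X t ω - X s ω)^2 + l⁻¹ := by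
        rw [← sq_abs (X t ω - X s ω)]
        set a := |X t ω - X s ω|
        have e : l * a^2 + l⁻¹ - a = l⁻¹ * ((1 - l*a/2)^2 + 3/4*(l*a)^2) := by field_simp; ring
        have : 0 ≤ l⁻¹ * ((1 - l*a/2)^2 + 3/4*(l*a)^2) := by positivity
        linarith
      have a4 := mul_le_mul_of_nonneg_left a3 hL
      linarith
  simp only [hfP, hfL, hfG, Set.indicator_of_mem hω]
  have e3 : qL b (X s ω) * (X t ω - X s ω) = qL b (X s ω) * (gM β δ x X t ω - gM β δ x X s ω)
      + qL b (X s ω) * gI β δ X s t ω := by rw [hinc]; ring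
  refine main.trans ?_
  nlinarith

def Hs (X : ℝ → Ω → ℝ) (b d : ℝ) (i : ℕ) : Set Ω :=
  {ω | ∀ j ∈ Finset.range i, |X (((j + 1 : ℕ) : ℝ) * d) ω - X ((j : ℝ) * d) ω| ≤ b}

def Gs (X : ℝ → Ω → ℝ) (R b d : ℝ) (i : ℕ) : Set Ω :=
  {ω | ∀ j ∈ Finset.range (i + 1), |X ((j : ℝ) * d) ω| ≤ R} ∩ Hs X b d i

lemma Ctx.adm (h : Ctx P ℱ β δ σ c x X T B D) {s t : ℝ} (hst : s ≤ t) : Measurable[ℱ t] (X s) :=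
  (h.adapted s).mono (ℱ.mono hst) le_rfl

lemma Ctx.measH (h : Ctx P ℱ β δ σ c x X T B D) (b : ℝ) {d : ℝ} (hd : 0 ≤ d) (i : ℕ) :
    MeasurableSet[ℱ (i * d)] (Hs X b d i) := by
  have : Hs X b d i = ⋂ j ∈ Finset.range i,
      {ω | |X (((j + 1 : ℕ) : ℝ) * d) ω - X ((j : ℝ) * d) ω| ≤ b} := by
    ext ω; simp only [Hs, Set.mem_ofPred_eq, Set.mem_iInter]
  rw [this]
  refine @Finset.measurableSet_biInter _ _ (ℱ (i * d)) _ _ fun j hj => ?_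
  have hj := Finset.mem_range.1 hj
  have h1 : (((j + 1 : ℕ) : ℝ) * d) ≤ i * d := by
    gcongr; exact_mod_cast hj
  have h2 : ((j : ℝ) * d) ≤ i * d := by
    gcongr
  have hf : Measurable fun q : ℝ × ℝ => |q.1 - q.2| := by fun_prop
  exact (hf.comp ((h.adm h1).prodMk (h.adm h2))) measurableSet_Iic

lemma Ctx.measG (h : Ctx P ℱ β δ σ c x X T B D) (R b : ℝ) {d : ℝ} (hd : 0 ≤ d) (i : ℕ) :
    MeasurableSet[ℱ (i * d)] (Gs X R b d i) := by
  refine MeasurableSet.inter ?_ (h.measH b hd i)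
  have : {ω | ∀ j ∈ Finset.range (i + 1), |X ((j : ℝ) * d) ω| ≤ R}
     = ⋂ j ∈ Finset.range (i + 1), {ω | |X ((j : ℝ) * d) ω| ≤ R} := by
    ext ω; simp only [Set.mem_ofPred_eq, Set.mem_iInter]
  rw [this]
  refine @Finset.measurableSet_biInter _ _ (ℱ (i * d)) _ _ fun j hj => ?_
  have hj := Finset.mem_range.1 hj
  have h2 : ((j : ℝ) * d) ≤ i * d := by
    gcongr; exact_mod_cast Nat.lt_succ_iff.1 hj
  have hf : Measurable fun q : ℝ => |q| := by fun_prop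
  exact (hf.comp (h.adm h2)) measurableSet_Iic

def kap (B R L c b l K d : ℝ) : ℝ :=
  2 * B * R + 2 * B * L * (l + K * d / l) + 2 * (c^2 * (1 + b⁻¹ * (l + K * d / l)))
    + 2 * b⁻¹ * (K * d) + L * l * K

lemma Ctx.iter (h : Ctx P ℱ β δ σ c x X T B D) :
    ∃ K, 0 ≤ K ∧ ∀ b R l : ℝ, 0 < b → b ≤ R → 0 < l → ∀ d, 0 ≤ d → ∀ i : ℕ, i * d ≤ T →
      ∫ ω, (Gs X R b d i).indicator (fun ω => qPhi b (X (i * d) ω)) ω ∂P ≤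
        Real.exp (2 * B * (i * d)) * (i * d * kap B R (Real.log (R / b)) c b l K d
          + Real.log (R / b) * l⁻¹ * (1 - P.real (Hs X b d i))) := by
  have := h.prob
  have hB := h.hB
  obtain ⟨K, hK, hmom⟩ := h.moments
  refine ⟨K, hK, fun b R l hb hR hl d hd i => ?_⟩
  have hL : 0 ≤ Real.log (R / b) := Real.log_nonneg (by rw [le_div_iff₀ hb]; linarith)
  have hR0 : 0 ≤ R := by linarith
  set L := Real.log (R / b) with hLd
  have hkap : 0 ≤ kap B R L c b l K d := by unfold kap; positivity
  induction i with
  | zero =>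
    intro _
    have e : ∀ ω, (Gs X R b d 0).indicator (fun ω => qPhi b (X ((0:ℕ) * d) ω)) ω = 0 := by
      intro ω
      have : qPhi b (X ((0:ℕ) * d) ω) = 0 := by
        have hx := h.hx
        simp only [Nat.cast_zero, zero_mul, h.init]
        have : max (-x) b = b := max_eq_right (by linarith)
        simp [qPhi, this, hb.ne']
      by_cases hω : ω ∈ Gs X R b d 0
      · rw [Set.indicator_of_mem hω]; exact this
      · exact Set.indicator_of_notMem hω _
    rw [integral_congr_ae (Eventually.of_forall e)]
    have : 0 ≤ 1 - P.real (Hs X b d 0) := by linarith [measureReal_le_one (μ := P) (s := Hs X b d 0)]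
    simp only [integral_zero, Nat.cast_zero, zero_mul, zero_add, mul_zero, Real.exp_zero, one_mul]
    positivity
  | succ i ih =>
    intro hi
    have hile : (i : ℝ) * d ≤ ((i + 1 : ℕ) : ℝ) * d := by gcongr; simp
    have ih := ih (hile.trans hi)
    have hdd : ((i + 1 : ℕ) : ℝ) * d - i * d = d := by push_cast; ring
    have hs0 : 0 ≤ (i : ℝ) * d := by positivity
    obtain ⟨m1, m2, m3⟩ := hmom (i * d) ((i + 1 : ℕ) * d) hs0 hile hi
    have hsub : Gs X R b d (i + 1) ⊆ Gs X R b d i := fun ω hω =>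
      ⟨fun j hj => hω.1 j (Finset.mem_range.2 ((Finset.mem_range.1 hj).trans (Nat.lt_succ_self _))),
       fun j hj => hω.2 j (Finset.mem_range.2 ((Finset.mem_range.1 hj).trans (Nat.lt_succ_self _)))⟩
    have st := h.step hs0 hile hi hb hR hl m1 m2 (m3 l hl) (h.measG R b hd i)
      (fun ω hω => hω.1 i (Finset.self_mem_range_succ i)) hsub
      (fun ω hω => hω.2 i (Finset.self_mem_range_succ i))
    rw [hdd, ← hLd] at st
    have hHm : ∀ k, MeasurableSet (Hs X b d k) := fun k => ℱ.le _ _ (h.measH b hd k)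
    have hHsub : Hs X b d (i + 1) ⊆ Hs X b d i := fun ω hω =>
       fun j hj => hω j (Finset.mem_range.2 ((Finset.mem_range.1 hj).trans (Nat.lt_succ_self _)))
    have hbad : P.real (Gs X R b d i ∩ {ω | b < |X ((i + 1 : ℕ) * d) ω - X (i * d) ω|})
        ≤ P.real (Hs X b d i) - P.real (Hs X b d (i + 1)) := by
      rw [← measureReal_sdiff hHsub (hHm _)]
      refine measureReal_mono (fun ω hω => ⟨hω.1.2, fun hh => ?_⟩)
      exact absurd (hh i (Finset.self_mem_range_succ i)) (not_le.2 hω.2)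
    have hP0 : 0 ≤ 1 - P.real (Hs X b d i) := by
      linarith [measureReal_le_one (μ := P) (s := Hs X b d i)]
    have hP1 : 0 ≤ P.real (Hs X b d i) - P.real (Hs X b d (i+1)) := by
      linarith [measureReal_mono (μ := P) hHsub]
    set a := ∫ ω, (Gs X R b d i).indicator (fun ω => qPhi b (X (i * d) ω)) ω ∂P
    set p := P.real (Hs X b d i) with hp
    set p' := P.real (Hs X b d (i+1)) with hp'
    set E := Real.exp (2 * B * (i * d)) with hE
    set E' := Real.exp (2 * B * ((i + 1 : ℕ) * d)) with hE'
    have hE1 : (1 + 2 * B * d) * E ≤ E' := by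
      have : E' = Real.exp (2 * B * d) * E := by
        rw [hE, hE', ← Real.exp_add]; congr 1; push_cast; ring
      rw [this]
      gcongr
      linarith [Real.add_one_le_exp (2 * B * d)]
    have hE2 : 1 ≤ E' := Real.one_le_exp (by positivity)
    have hq : 2 * B * R * d + 2 * B * L * ((l + K * d / l) * d)
        + 2 * (c^2 * (d + b⁻¹ * ((l + K * d / l) * d))) + 2 * b⁻¹ * (K * d^2)
        + L * l * (K * d) = d * kap B R L c b l K d := by unfold kap; ring
    rw [hq] at st
    set k := kap B R L c b l K d
    have hll : 0 ≤ L * l⁻¹ := by positivity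
    set lam := L * l⁻¹
    have s1 := mul_le_mul_of_nonneg_left hbad hll
    have s2 := mul_le_mul_of_nonneg_left ih (by positivity : 0 ≤ 1 + 2 * B * d)
    have hY : 0 ≤ i * d * k + lam * (1 - p) := by positivity
    have s3 := mul_le_mul_of_nonneg_right hE1 hY
    have hZ : 0 ≤ d * k + lam * (p - p') := by positivity
    have s4 := mul_le_mul_of_nonneg_right hE2 hZ
    calc _ ≤ E' * (i * d * k + lam * (1 - p)) + E' * (d * k + lam * (p - p')) := by linarith
      _ = _ := by push_cast; ring

lemma Ctx.limH (h : Ctx P ℱ β δ σ c x X T B D) {b : ℝ} (hb : 0 < b) :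
    Tendsto (fun N : ℕ => P.real (Hs X b (T / N) N)) atTop (nhds 1) := by
  have := h.prob
  have hT := h.hT
  have hm : ∀ N : ℕ, MeasurableSet (Hs X b (T / N) N) := fun N =>
    ℱ.le _ _ (h.measH b (by positivity) N)
  have e : ∀ N : ℕ, P.real (Hs X b (T / N) N)
      = ∫ ω, (Hs X b (T / N) N).indicator (fun _ => (1:ℝ)) ω ∂P := fun N => by
    rw [integral_indicator (hm N)]; simp
  simp_rw [e]
  have e1 : (1:ℝ) = ∫ ω : Ω, (1:ℝ) ∂P := by simp
  conv => rhs; rw [e1]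
  refine tendsto_integral_of_dominated_convergence (fun _ => 1)
    (fun N => (measurable_const.indicator (hm N)).aestronglyMeasurable) (integrable_const _)
    (fun N => Eventually.of_forall fun ω => ?_) (Eventually.of_forall fun ω => ?_)
  · refine (norm_indicator_le_norm_self _ _).trans (by simp)
  · have hu : UniformContinuousOn (fun t => X t ω) (Set.Icc 0 T) :=
      isCompact_Icc.uniformContinuousOn_of_continuous (h.cont ω).continuousOn
    rw [Metric.uniformContinuousOn_iff_le] at hu
    obtain ⟨d, hd, hu⟩ := hu b hb
    have ht : ∀ᶠ N : ℕ in atTop, T / N < d :=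
      (tendsto_const_div_atTop_nhds_zero_nat T).eventually_lt_const hd
    refine tendsto_const_nhds.congr' ?_
    filter_upwards [ht, eventually_gt_atTop 0] with N hN hN0
    have hN0' : (0:ℝ) < N := by exact_mod_cast hN0
    rw [Set.indicator_of_mem]
    intro j hj
    have hj' : ((j + 1 : ℕ) : ℝ) ≤ N := by exact_mod_cast Finset.mem_range.1 hj
    have hTN : (N:ℝ) * (T / N) = T := by field_simp
    have hpos : 0 ≤ T / N := by positivity
    have a1 : ((j + 1 : ℕ) : ℝ) * (T / N) ≤ T :=
      (mul_le_mul_of_nonneg_right hj' hpos).trans hTN.le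
    have a2 : (j : ℝ) * (T / N) ≤ ((j + 1 : ℕ) : ℝ) * (T / N) := by gcongr; simp
    refine hu _ ⟨by positivity, a1⟩ _ ⟨by positivity, a2.trans a1⟩ ?_
    rw [Real.dist_eq]
    have : ((j + 1 : ℕ) : ℝ) * (T / N) - j * (T / N) = T / N := by push_cast; ring
    rw [this, abs_of_nonneg hpos]
    exact hN.le

lemma qPhi_ge {b η y : ℝ} (hb : 0 < b) (hη : b < η) (hy : y < -η) :
    η * Real.log (η / b) - η ≤ qPhi b y := by
  have hη0 : 0 < η := hb.trans hη
  have h1 : η ≤ -y := by linarith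
  have hm : max (-y) b = -y := max_eq_left (by linarith)
  have hp : 0 < -y := by linarith
  have h2 := log_ge_aux (z := -y / η) (by positivity)
  have h3 := mul_le_mul_of_nonneg_left h2 hp.le
  have e1 : -y * (1 - 1 / (-y / η)) = -y - η := by
    have : y ≠ 0 := fun h0 => by linarith
    field_simp; ring
  have e2 : Real.log (-y / b) = Real.log (-y / η) + Real.log (η / b) := by
    rw [← Real.log_mul (by positivity) (by positivity)]; congr 1; field_simp
  have h4 : 0 ≤ Real.log (η / b) := Real.log_nonneg (by rw [le_div_iff₀ hb]; linarith)
  have h5 := mul_le_mul_of_nonneg_right h1 h4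
  unfold qPhi
  rw [hm, e2]
  rw [e1] at h3
  linarith

lemma Ctx.bound (h : Ctx P ℱ β δ σ c x X T B D) {η R : ℝ}
    {b : ℝ} (hb : 0 < b) (hbη : b < η) (hbR : b ≤ R) :
    (η * Real.log (η / b) - η) * P.real {ω | X T ω < -η ∧ ∀ r ∈ Set.Icc 0 T, |X r ω| ≤ R} ≤
      Real.exp (2 * B * T) * (T * (2 * B * R + 2 * c^2)) +
      max (η * Real.log (η / b) - η) 0 * 0 := by
  have := h.prob
  have hT := h.hT
  obtain ⟨K, hK, hit⟩ := h.iter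
  set φ := η * Real.log (η / b) - η with hφ
  set A := {ω | X T ω < -η ∧ ∀ r ∈ Set.Icc 0 T, |X r ω| ≤ R} with hA
  set L := Real.log (R / b) with hL
  have hR : b ≤ R := hbR
  have hmono : ∀ l > 0, ∀ N : ℕ, 0 < N → φ * P.real A ≤
      Real.exp (2 * B * T) * (T * kap B R L c b l K (T / N)
        + L * l⁻¹ * (1 - P.real (Hs X b (T / N) N)))
        + max φ 0 * (1 - P.real (Hs X b (T / N) N)) := by
    intro l hl N hN
    have hN0 : (0:ℝ) < N := by exact_mod_cast hN
    have hTN : (N:ℝ) * (T / N) = T := by field_simp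
    have hpos : 0 ≤ T / N := by positivity
    have h1 := hit b R l hb hR hl (T / N) hpos N hTN.le
    rw [hTN] at h1
    have hGm : MeasurableSet (Gs X R b (T / N) N) := ℱ.le _ _ (h.measG R b hpos N)
    have hHm : MeasurableSet (Hs X b (T / N) N) := ℱ.le _ _ (h.measH b hpos N)
    set F := Gs X R b (T / N) N ∩ {ω | X T ω < -η} with hF
    have hFm : MeasurableSet F := hGm.inter (measurableSet_lt (h.measXt T) measurable_const)
    have hsub : A ⊆ F ∪ (Hs X b (T / N) N)ᶜ := by
      rintro ω ⟨w1, w2⟩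
      by_cases hH : ω ∈ Hs X b (T / N) N
      · refine Or.inl ⟨⟨fun j hj => w2 _ ⟨by positivity, ?_⟩, hH⟩, w1⟩
        have : (j:ℝ) ≤ N := by exact_mod_cast Nat.lt_succ_iff.1 (Finset.mem_range.1 hj)
        calc (j:ℝ) * (T / N) ≤ N * (T / N) := by gcongr
          _ = T := hTN
      · exact Or.inr hH
    have h2 : P.real A ≤ P.real F + (1 - P.real (Hs X b (T / N) N)) := by
      rw [← probReal_compl_eq_one_sub hHm]
      exact (measureReal_mono hsub).trans (measureReal_union_le _ _)
    have h3 : φ * P.real F ≤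
        ∫ ω, (Gs X R b (T / N) N).indicator (fun ω => qPhi b (X T ω)) ω ∂P := by
      have e : φ * P.real F = ∫ ω, F.indicator (fun _ => φ) ω ∂P := by
        rw [integral_indicator hFm]; simp [mul_comm]
      rw [e]
      refine integral_mono ((integrable_const _).indicator hFm) ?_ fun ω => ?_
      · refine Integrable.of_bound (C := R * Real.log (R / b))
          (((meas_qPhi b).comp (h.measXt T)).indicator hGm).aestronglyMeasurable
          (Eventually.of_forall fun ω => ?_)
        have hL0 : 0 ≤ Real.log (R / b) := Real.log_nonneg (by rw [le_div_iff₀ hb]; linarith)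
        have hR0 : 0 ≤ R := by linarith
        by_cases hω : ω ∈ Gs X R b (T / N) N
        · rw [Set.indicator_of_mem hω, Real.norm_of_nonneg (qPhi_nonneg hb _)]
          have := hω.1 N (Finset.self_mem_range_succ N)
          rw [hTN] at this
          exact qPhi_le hb hR this
        · simp only [Set.indicator_of_notMem hω, norm_zero]; positivity
      · by_cases hω : ω ∈ F
        · rw [Set.indicator_of_mem hω, Set.indicator_of_mem hω.1]
          exact qPhi_ge hb hbη hω.2
        · rw [Set.indicator_of_notMem hω]
          exact Set.indicator_nonneg (fun _ _ => qPhi_nonneg hb _) ω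
    rcases le_or_gt φ 0 with h0 | h0
    · have a2 : φ * P.real A ≤ 0 := mul_nonpos_of_nonpos_of_nonneg h0 measureReal_nonneg
      have a3 : 0 ≤ ∫ ω, (Gs X R b (T / N) N).indicator (fun ω => qPhi b (X T ω)) ω ∂P :=
        integral_nonneg fun ω => Set.indicator_nonneg (fun _ _ => qPhi_nonneg hb _) ω
      rw [max_eq_right h0, zero_mul, add_zero]
      linarith
    · rw [max_eq_left h0.le]
      have := mul_le_mul_of_nonneg_left h2 h0.le
      linarith
  have lim1 : Tendsto (fun N : ℕ => 1 - P.real (Hs X b (T / N) N)) atTop (nhds 0) := by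
    simpa using (tendsto_const_nhds (x := (1:ℝ))).sub (h.limH hb)
  have lim2 : Tendsto (fun N : ℕ => T / (N:ℝ)) atTop (nhds 0) :=
    tendsto_const_div_atTop_nhds_zero_nat T
  have step1 : ∀ l > 0, φ * P.real A ≤ Real.exp (2 * B * T) * (T * kap B R L c b l K 0) := by
    intro l hl
    have ck : Continuous fun d => kap B R L c b l K d := by unfold kap; fun_prop
    have lk := (ck.tendsto 0).comp lim2
    have lt := ((((lk.const_mul T).add (lim1.const_mul (L * l⁻¹))).const_mul
      (Real.exp (2 * B * T))).add (lim1.const_mul (max φ 0)))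
    simp only [mul_zero, add_zero] at lt
    refine ge_of_tendsto lt ?_
    filter_upwards [eventually_gt_atTop 0] with N hN
    exact hmono l hl N hN
  have cl : Continuous fun l : ℝ => Real.exp (2 * B * T) * (T * (2 * B * R + 2 * B * L * l
      + 2 * (c^2 * (1 + b⁻¹ * l)) + L * l * K)) := by fun_prop
  have ll := (cl.tendsto 0).mono_left (nhdsWithin_le_nhds (s := Set.Ioi 0))
  have fin := ge_of_tendsto (b := φ * P.real A) ll (by
    filter_upwards [self_mem_nhdsWithin] with l hl
    have := step1 l hl
    simpa [kap] using this)
  simpa using fin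

lemma Ctx.null (h : Ctx P ℱ β δ σ c x X T B D) {η R : ℝ} (hη : 0 < η) (hR : 0 < R) :
    P {ω | X T ω < -η ∧ ∀ r ∈ Set.Icc 0 T, |X r ω| ≤ R} = 0 := by
  have := h.prob
  rw [← measureReal_eq_zero_iff]
  set p := P.real {ω | X T ω < -η ∧ ∀ r ∈ Set.Icc 0 T, |X r ω| ≤ R} with hp
  by_contra hne
  have hp0 : 0 < p := lt_of_le_of_ne measureReal_nonneg (Ne.symm hne)
  set C := Real.exp (2 * B * T) * (T * (2 * B * R + 2 * c^2)) with hC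
  have lim : Tendsto (fun n : ℕ => η * Real.exp (-(n:ℝ))) atTop (nhds 0) := by
    have := (Real.tendsto_exp_neg_atTop_nhds_zero.comp tendsto_natCast_atTop_atTop).const_mul η
    simpa using this
  have ev1 := lim.eventually_lt_const (lt_min hη hR)
  have ev2 : ∀ᶠ n : ℕ in atTop, C / p < η * n - η := by
    have : Tendsto (fun n : ℕ => η * (n:ℝ) - η) atTop atTop :=
      tendsto_atTop_add_const_right _ _ (tendsto_natCast_atTop_atTop.const_mul_atTop hη)
    exact this.eventually_gt_atTop _
  obtain ⟨n, h1, h2⟩ := (ev1.and ev2).exists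
  have hb := h.bound (b := η * Real.exp (-(n:ℝ))) (R := R) (by positivity)
    (h1.trans_le (min_le_left _ _)) (h1.trans_le (min_le_right _ _)).le
  have e : Real.log (η / (η * Real.exp (-(n:ℝ)))) = n := by
    have : η / (η * Real.exp (-(n:ℝ))) = Real.exp n := by
      rw [Real.exp_neg]; field_simp
    rw [this, Real.log_exp]
  rw [e, mul_zero, add_zero, ← hC, ← hp] at hb
  rw [div_lt_iff₀ hp0] at h2
  linarith

lemma Ctx.final (h : Ctx P ℱ β δ σ c x X T B D) : P {ω | 0 ≤ X T ω} = 1 := by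
  have := h.prob
  rw [← prob_compl_eq_zero_iff (measurableSet_le measurable_const (h.measXt T))]
  refine measure_mono_null (t := ⋃ k : ℕ, ⋃ n : ℕ, {ω | X T ω < -(1 / ((k:ℝ) + 1)) ∧
    ∀ r ∈ Set.Icc 0 T, |X r ω| ≤ (n:ℝ) + 1}) ?_ ?_
  · intro ω hω
    have hω : X T ω < 0 := not_le.1 hω
    obtain ⟨k, hk⟩ := exists_nat_one_div_lt (neg_pos.2 hω)
    obtain ⟨C, hC⟩ := isCompact_Icc.exists_bound_of_continuousOn (h.cont ω).continuousOn (s := Set.Icc 0 T)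
    obtain ⟨n, hn⟩ := exists_nat_ge C
    refine Set.mem_iUnion.2 ⟨k, Set.mem_iUnion.2 ⟨n, by linarith, fun r hr => ?_⟩⟩
    have := hC r hr
    rw [Real.norm_eq_abs] at this
    linarith
  · exact measure_iUnion_null fun k => measure_iUnion_null fun n =>
      h.null (by positivity) (by positivity)

end ctx

/-- Nonnegativity of solutions of
`dX_u = (2 β_u X_u + δ_u) du + σ(X_u) dW_u`, `X_0 = x ≥ 0`. -/
theorem gbesq_nonneg {Ω : Type} [m : MeasurableSpace Ω]
    (P : Measure Ω) [IsProbabilityMeasure P] (ℱ : Filtration ℝ m)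
    (W : ℝ → Ω → ℝ) (hW : IsBrownianMotion P ℱ W)
    (β δ : ℝ → ℝ) (hβ : MemD β) (hδ : MemD δ)
    (σ : ℝ → ℝ) (hσ0 : σ 0 = 0) (hσpos : ∀ y, 0 ≤ σ y)
    (c : ℝ) (hHolder : ∀ x y : ℝ, |σ x - σ y| ≤ c * Real.sqrt |x - y|)
    (x : ℝ) (hx : 0 ≤ x) (X : ℝ → Ω → ℝ)
    (hX : IsSDESolution P ℱ W (gbesqDrift β δ) σ x X) :
    ∀ u : ℝ, 0 ≤ u → P {ω | 0 ≤ X u ω} = 1 := by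
  intro u hu
  rcases hu.eq_or_lt with rfl | hu
  · have : {ω | 0 ≤ X 0 ω} = Set.univ := by
      ext ω; simp [hX.init ω, hx]
    rw [this, measure_univ]
  obtain ⟨mβ, β0, βb, -⟩ := hβ
  obtain ⟨mδ, δ0, δb, -⟩ := hδ
  obtain ⟨B, hB⟩ := βb u
  obtain ⟨D, hD⟩ := δb u
  have h0 : (0:ℝ) ∈ Set.Icc (0:ℝ) u := ⟨le_rfl, hu.le⟩
  have hctx : Ctx P ℱ β δ σ c x X u B D :=
    { prob := inferInstance
      hT := hu
      hB := (β0 0).trans (hB 0 h0)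
      hD := (δ0 0).trans (hD 0 h0)
      hx := hx
      mβ := mβ
      mδ := mδ
      β0 := β0
      δ0 := δ0
      βB := hB
      δD := hD
      σ0 := hσ0
      hol := hHolder
      init := hX.init
      cont := hX.cont
      adapted := hX.adapted
      mM := hX.drift_mart
      mQ := hX.quad_var }
  exact hctx.final
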